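/- arXiv:2605.19096 — 2 statements merged into one kernel-verified Lean document; each statement's English description precedes it below -/
import Mathlib

section
/- Let Ω ∈ K^{n×ℓ} be a random embedding that has full column rank almost surely and satisfies UΩ ~ Ω for each unitary U ∈ K^{n×n}. Then for any matrix A ∈ K^{d×n}, E‖A − Π_{AΩ}A‖_F² ≤ min over natural numbers q with q < ℓ − α_K of (1 + q/(ℓ − q − α_K)) · ‖A − [A]_q‖_F². -/
open MeasureTheory ProbabilityTheory Matrix Filter
open scoped ENNReal Topology ComplexOrder

noncomputable section

open Classical in
/-- `α_K`: 1 if `K = ℝ`, 0 if `K = ℂ`. -/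
def alphaK (K : Type*) [RCLike K] : ℝ := if (RCLike.I : K) = 0 then 1 else 0

/-- Squared Frobenius norm of a matrix. -/
def frobSq {K : Type*} [RCLike K] {m n : Type*} [Fintype m] [Fintype n]
    (A : Matrix m n K) : ℝ := ∑ i, ∑ j, ‖A i j‖ ^ 2

/-- The four Penrose conditions characterizing the Moore–Penrose pseudoinverse. -/
def IsMoorePenrose {K : Type*} [RCLike K] {m n : Type*} [Fintype m] [Fintype n]
    (A : Matrix m n K) (X : Matrix n m K) : Prop :=
  A * X * A = A ∧ X * A * X = X ∧ (A * X)ᴴ = A * X ∧ (X * A)ᴴ = X * A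

instance matrixMeasurableSpace {m n α : Type*} [MeasurableSpace α] :
    MeasurableSpace (Matrix m n α) :=
  inferInstanceAs (MeasurableSpace (m → n → α))

/-- `M` is rotation-invariant: `U * M` has the same distribution as `M` for every unitary `U`. -/
def RotationInvariant {K : Type*} [RCLike K] [MeasurableSpace K]
    {Y : Type*} [MeasurableSpace Y] (μ : Measure Y) {n ℓ : ℕ}
    (M : Y → Matrix (Fin n) (Fin ℓ) K) : Prop :=
  ∀ U : Matrix (Fin n) (Fin n) K, U ∈ Matrix.unitaryGroup (Fin n) K →
    Measure.map (fun ω => U * M ω) μ = Measure.map M μ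

/-- `M` is a random orthonormal embedding: rotation-invariant, with orthonormal
columns almost surely. -/
def IsRandomOrthonormal {K : Type*} [RCLike K] [MeasurableSpace K]
    {Y : Type*} [MeasurableSpace Y] (μ : Measure Y) {n ℓ : ℕ}
    (M : Y → Matrix (Fin n) (Fin ℓ) K) : Prop :=
  Measurable M ∧ RotationInvariant μ M ∧ ∀ᵐ ω ∂μ, (M ω)ᴴ * M ω = 1

/-- `Aq` is a best rank-`q` approximation of `A` in Frobenius norm
(equivalently, a matrix obtained from a `q`-truncated SVD of `A`). -/
def IsBestRankApprox {K : Type*} [RCLike K] {m n : Type*} [Fintype m] [Fintype n]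
    [DecidableEq n] (q : ℕ) (A Aq : Matrix m n K) : Prop :=
  Aq.rank ≤ q ∧ ∀ B : Matrix m n K, B.rank ≤ q → frobSq (A - Aq) ≤ frobSq (A - B)

set_option linter.unusedSectionVars false


namespace RSVD

/-- Entrywise derivative of a matrix-valued curve. -/
def MD {K : Type*} [RCLike K] {m n : Type*} (f : ℝ → Matrix m n K) (f' : Matrix m n K)
    (t : ℝ) : Prop := ∀ i j, HasDerivAt (fun s => f s i j) (f' i j) t

section MD
variable {K : Type*} [RCLike K] {l m n p r : Type*}

lemma MD.const (A : Matrix m n K) (t : ℝ) : MD (fun _ => A) 0 t :=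
  fun i j => by simpa using hasDerivAt_const t (A i j)

lemma MD.add {f g : ℝ → Matrix m n K} {f' g' : Matrix m n K} {t : ℝ}
    (hf : MD f f' t) (hg : MD g g' t) : MD (fun s => f s + g s) (f' + g') t :=
  fun i j => (hf i j).add (hg i j)

lemma MD.mul [Fintype m] {f : ℝ → Matrix l m K} {g : ℝ → Matrix m n K} {f' : Matrix l m K}
    {g' : Matrix m n K} {t : ℝ}
    (hf : MD f f' t) (hg : MD g g' t) :
    MD (fun s => f s * g s) (f' * g t + f t * g') t := by
  intro i j
  simp only [Matrix.mul_apply, Matrix.add_apply, ← Finset.sum_add_distrib]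
  exact HasDerivAt.fun_sum fun k _ => (hf i k).mul (hg k j)

lemma MD.trace [Fintype m] {f : ℝ → Matrix m m K} {f' : Matrix m m K} {t : ℝ} (hf : MD f f' t) :
    HasDerivAt (fun s => (f s).trace) f'.trace t := by
  simp only [Matrix.trace, Matrix.diag]
  exact HasDerivAt.fun_sum fun k _ => hf k k

lemma MD.conjTranspose {f : ℝ → Matrix m n K} {f' : Matrix m n K} {t : ℝ} (hf : MD f f' t) :
    MD (fun s => (f s)ᴴ) f'ᴴ t := fun i j => (hf j i).star

lemma MD.tendsto {f : ℝ → Matrix m n K} {f' : Matrix m n K} {t : ℝ} (hf : MD f f' t) :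
    ContinuousAt f t :=
  tendsto_pi_nhds.2 fun i => tendsto_pi_nhds.2 fun j => (hf i j).continuousAt

lemma MD.inv [Fintype m] [DecidableEq m] {f : ℝ → Matrix m m K} {f' : Matrix m m K} {t : ℝ}
    (hf : MD f f' t) (hu : IsUnit (f t).det) :
    MD (fun s => (f s)⁻¹) (-((f t)⁻¹ * f' * (f t)⁻¹)) t := by
  have hc : ContinuousAt f t := hf.tendsto
  have hdet : ContinuousAt (fun s => (f s).det) t :=
    (Continuous.matrix_det continuous_id).continuousAt.comp hc
  have hev : ∀ᶠ s in 𝓝 t, IsUnit (f s).det := by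
    filter_upwards [hdet.eventually_ne hu.ne_zero] with s hs
    exact hs.isUnit
  have hinv : ContinuousAt (fun s => (f s)⁻¹) t := by
    refine (continuousAt_matrix_inv (f t) ?_).comp hc
    simpa [Ring.inverse_eq_inv'] using continuousAt_inv₀ hu.ne_zero
  intro i j
  rw [hasDerivAt_iff_tendsto_slope]
  have h1 : Tendsto (fun s => -((f s)⁻¹ * (s - t)⁻¹ • (f s - f t) * (f t)⁻¹)) (𝓝[≠] t)
      (𝓝 (-((f t)⁻¹ * f' * (f t)⁻¹))) := by
    have h2 : Tendsto (fun s => (s - t)⁻¹ • (f s - f t)) (𝓝[≠] t) (𝓝 f') := by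
      refine tendsto_pi_nhds.2 fun i => tendsto_pi_nhds.2 fun j => ?_
      have := (hasDerivAt_iff_tendsto_slope.1 (hf i j))
      simpa [slope, slope_fun_def] using this
    have h3 := hinv.tendsto.mono_left (nhdsWithin_le_nhds (s := {t}ᶜ))
    exact ((h3.mul h2).mul tendsto_const_nhds).neg
  have h4 := (tendsto_pi_nhds.1 ((tendsto_pi_nhds.1 h1) i)) j
  refine h4.congr' ?_
  filter_upwards [nhdsWithin_le_nhds hev] with s hs
  have : (f s)⁻¹ * (s - t)⁻¹ • (f s - f t) * (f t)⁻¹ = -((s - t)⁻¹ • ((f s)⁻¹ - (f t)⁻¹)) := by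
    rw [Matrix.mul_smul, Matrix.smul_mul, Matrix.mul_sub, Matrix.sub_mul,
      Matrix.nonsing_inv_mul _ hs, Matrix.mul_assoc, Matrix.mul_nonsing_inv _ hu]
    rw [← smul_neg]; simp
  rw [this]
  simp [slope]

end MD

section exp
variable {K : Type*} [RCLike K] {m : Type*} [Fintype m] [DecidableEq m]

/-- The one-parameter group `exp (t X)`. -/
def Ut (X : Matrix m m K) (t : ℝ) : Matrix m m K := NormedSpace.exp (t • X)

open scoped Matrix.Norms.Operator in
lemma Ut_md (X : Matrix m m K) : MD (Ut X) X 0 := by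
  have h := hasDerivAt_exp_smul_const (𝕂 := ℝ) X (0 : ℝ)
  simp only [zero_smul, NormedSpace.exp_zero, one_mul] at h
  intro i j
  have h2 : HasDerivAt (fun s => (LinearMap.toContinuousLinearMap (Matrix.entryLinearMap ℝ K i j)) (Ut X s))
     _ 0 := (ContinuousLinearMap.hasFDerivAt _).comp_hasDerivAt (0:ℝ) h
  exact h2

lemma Ut_zero (X : Matrix m m K) : Ut X 0 = 1 := by simp [Ut]

lemma Ut_add (X : Matrix m m K) (s t : ℝ) : Ut X (s + t) = Ut X s * Ut X t := by
  rw [Ut, add_smul, Matrix.exp_add_of_commute]; rfl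
  exact ((Commute.refl X).smul_left s).smul_right t

lemma Ut_conj {X : Matrix m m K} (hX : Xᴴ = -X) (t : ℝ) : (Ut X t)ᴴ = Ut X (-t) := by
  rw [Ut, ← Matrix.exp_conjTranspose, Matrix.conjTranspose_smul, hX, Ut]; simp

lemma Ut_unitary {X : Matrix m m K} (hX : Xᴴ = -X) (t : ℝ) :
    Ut X t ∈ Matrix.unitaryGroup m K := by
  rw [Matrix.mem_unitaryGroup_iff, Matrix.star_eq_conjTranspose, Ut_conj hX, ← Ut_add]
  simp [Ut_zero]

end exp

section compact
variable {K : Type*} [RCLike K] {m n : Type*} [Fintype m] [DecidableEq m]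

instance borelMatrix [Countable m] [Countable n] [MeasurableSpace K] [BorelSpace K] :
    BorelSpace (Matrix m n K) :=
  inferInstanceAs (BorelSpace (m → n → K))

instance secMatrix [Countable m] [Countable n] : SecondCountableTopology (Matrix m n K) :=
  inferInstanceAs (SecondCountableTopology (m → n → K))

instance metrMatrix [Fintype n] : TopologicalSpace.PseudoMetrizableSpace (Matrix m n K) :=
  inferInstanceAs (TopologicalSpace.PseudoMetrizableSpace (m → n → K))

instance t2Matrix : T2Space (Matrix m n K) :=
  inferInstanceAs (T2Space (m → n → K))

/-- Orthogonal projection matrices with trace `l`. -/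
def PS (K : Type*) [RCLike K] (m : Type*) [Fintype m] (l : ℕ) : Set (Matrix m m K) :=
  {P | Pᴴ = P ∧ P * P = P ∧ P.trace = l}

lemma PS_entry {l : ℕ} {P : Matrix m m K} (hP : P ∈ PS K m l) (i j : m) : ‖P i j‖ ≤ 1 := by
  obtain ⟨h1, h2, -⟩ := hP
  have h3 : ∀ i, ((P i i : K)) = ((∑ j, ‖P i j‖ ^ 2 : ℝ) : K) := by
    intro i
    conv_lhs => rw [← h2, Matrix.mul_apply]
    push_cast
    refine Finset.sum_congr rfl fun j _ => ?_
    have : P j i = star (P i j) := by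
      conv_lhs => rw [← h1]
      rfl
    rw [this]
    exact RCLike.mul_conj _
  have h4 : ∀ i j, ‖P i j‖ ^ 2 ≤ ‖P i i‖ := by
    intro i j
    rw [h3 i, RCLike.norm_ofReal, abs_of_nonneg (by positivity)]
    exact Finset.single_le_sum (f := fun j => ‖P i j‖ ^ 2) (fun _ _ => by positivity)
      (Finset.mem_univ j)
  have h5 : ‖P i i‖ ≤ 1 := by nlinarith [h4 i i, norm_nonneg (P i i)]
  nlinarith [h4 i j, norm_nonneg (P i j)]

lemma PS_compact (l : ℕ) : IsCompact (PS K m l) := by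
  have h1 : IsCompact (Set.pi Set.univ fun _ : m => Set.pi Set.univ fun _ : m =>
      Metric.closedBall (0 : K) 1) :=
    isCompact_univ_pi fun _ => isCompact_univ_pi fun _ => isCompact_closedBall _ _
  have hcl : IsClosed (PS K m l) := by
    refine IsClosed.inter (isClosed_eq ?_ ?_) (IsClosed.inter (isClosed_eq ?_ ?_)
      (isClosed_eq ?_ ?_)) <;> fun_prop
  refine IsCompact.of_isClosed_subset (X := Matrix m m K) h1 hcl ?_
  intro P hP i _ j _
  simpa using PS_entry hP i j

lemma PS_conj {l : ℕ} {P : Matrix m m K} (hP : P ∈ PS K m l) {U : Matrix m m K}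
    (hU : U ∈ Matrix.unitaryGroup m K) : U * P * Uᴴ ∈ PS K m l := by
  obtain ⟨h1, h2, h3⟩ := hP
  have hU' : Uᴴ * U = 1 := Matrix.mem_unitaryGroup_iff'.1 hU
  refine ⟨?_, ?_, ?_⟩
  · simp [Matrix.conjTranspose_mul, h1, Matrix.mul_assoc]
  · calc U * P * Uᴴ * (U * P * Uᴴ) = U * P * (Uᴴ * U) * P * Uᴴ := by simp only [Matrix.mul_assoc]
      _ = U * (P * P) * Uᴴ := by rw [hU']; simp only [Matrix.mul_assoc, Matrix.one_mul]
      _ = _ := by rw [h2]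
  · rw [Matrix.trace_mul_comm, ← Matrix.mul_assoc, hU', Matrix.one_mul, h3]

/-- Rotation-invariant probability law on projections. -/
structure InvLaw [MeasurableSpace K] (l : ℕ) (ν : Measure (Matrix m m K)) : Prop where
  prob : IsProbabilityMeasure ν
  mem : ∀ᵐ P ∂ν, P ∈ PS K m l
  inv : ∀ U ∈ Matrix.unitaryGroup m K, Measure.map (fun P => U * P * Uᴴ) ν = ν

variable [MeasurableSpace K] [BorelSpace K] {l : ℕ} {ν : Measure (Matrix m m K)}

lemma InvLaw.integrable (h : InvLaw l ν) {E : Type*} [NormedAddCommGroup E]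
    {g : Matrix m m K → E} (hg : ContinuousOn g (PS K m l)) : Integrable g ν := by
  have := h.prob
  have h1 : IntegrableOn g (PS K m l) ν := hg.integrableOn_compact (PS_compact l)
  rwa [IntegrableOn, Measure.restrict_eq_self_of_ae_mem h.mem] at h1

lemma InvLaw.integral_conj (h : InvLaw l ν) {E : Type*} [NormedAddCommGroup E] [NormedSpace ℝ E]
    {g : Matrix m m K → E} (hg : ContinuousOn g (PS K m l)) {U : Matrix m m K}
    (hU : U ∈ Matrix.unitaryGroup m K) : ∫ P, g (U * P * Uᴴ) ∂ν = ∫ P, g P ∂ν := by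
  have hm : Measurable (fun P : Matrix m m K => U * P * Uᴴ) :=
    Continuous.measurable (by fun_prop)
  have h2 := integral_map (μ := ν) (f := g) hm.aemeasurable
    (by rw [h.inv U hU]; exact (h.integrable hg).aestronglyMeasurable)
  rw [h.inv U hU] at h2
  exact h2.symm

lemma InvLaw.stein (h : InvLaw l ν) {g D : Matrix m m K → ℝ} (hg : ContinuousOn g (PS K m l))
    (hD : ContinuousOn D (PS K m l)) {X : Matrix m m K} (hX : Xᴴ = -X)
    (hd : ∀ P ∈ PS K m l, HasDerivAt (fun t => g (Ut X t * P * (Ut X t)ᴴ)) (D P) 0) :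
    ∫ P, D P ∂ν = 0 := by
  have := h.prob
  obtain ⟨C, hC⟩ := (PS_compact (K := K) (m := m) l).exists_bound_of_continuousOn hD
  have hcomp : ∀ t, ContinuousOn (fun P => g (Ut X t * P * (Ut X t)ᴴ)) (PS K m l) := by
    intro t
    refine hg.comp (Continuous.continuousOn (by fun_prop)) ?_
    intro P hP
    exact PS_conj hP (Ut_unitary hX t)
  have hz : ∀ P : Matrix m m K, Ut X 0 * P * (Ut X 0)ᴴ = P := by
    intro P; simp [Ut_zero]
  have key := hasDerivAt_integral_of_dominated_loc_of_deriv_le (μ := ν) (x₀ := (0 : ℝ))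
    (s := Set.univ) (bound := fun _ => C)
    (F := fun t P => g (Ut X t * P * (Ut X t)ᴴ)) (F' := fun t P => D (Ut X t * P * (Ut X t)ᴴ))
    Filter.univ_mem (Eventually.of_forall fun t => (h.integrable (hcomp t)).aestronglyMeasurable)
    (h.integrable (hcomp 0)) (by simpa [hz] using (h.integrable hD).aestronglyMeasurable)
    (by
      filter_upwards [h.mem] with P hP t _
      exact hC _ (PS_conj hP (Ut_unitary hX t)))
    (integrable_const C)
    (by
      filter_upwards [h.mem] with P hP t _
      have h1 := hd _ (PS_conj hP (Ut_unitary hX t))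
      have h2 : HasDerivAt (fun s : ℝ => s - t) 1 t := (hasDerivAt_id t).sub_const t
      rw [← sub_self t] at h1
      have h3 := HasDerivAt.comp (h := fun s : ℝ => s - t) t h1 h2
      simp only [mul_one] at h3
      refine h3.congr_of_eventuallyEq (Eventually.of_forall fun s => ?_)
      simp only [Function.comp]
      congr 1
      have : Ut X s = Ut X (s - t) * Ut X t := by rw [← Ut_add]; simp
      rw [this, Matrix.conjTranspose_mul]
      simp only [Matrix.mul_assoc])
  have hconst : (fun t => ∫ P, g (Ut X t * P * (Ut X t)ᴴ) ∂ν) = fun _ => ∫ P, g P ∂ν := by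
    funext t
    exact h.integral_conj hg (Ut_unitary hX t)
  have h5 := key.2
  rw [hconst] at h5
  have h6 := h5.unique (hasDerivAt_const (0 : ℝ) _)
  simpa [hz] using h6

end compact

section blocks
variable {K : Type*} [RCLike K] {p r : Type*} [Fintype p] [DecidableEq p] [Fintype r] [DecidableEq r]

lemma frobSq_eq {m n : Type*} [Fintype m] [Fintype n] (B : Matrix m n K) :
    frobSq B = RCLike.re (B * Bᴴ).trace := by
  simp only [frobSq, Matrix.trace, Matrix.diag, Matrix.mul_apply, map_sum,
    Matrix.conjTranspose_apply]
  refine Finset.sum_congr rfl fun i _ => Finset.sum_congr rfl fun j _ => ?_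
  have : B i j * star (B i j) = ((‖B i j‖ ^ 2 : ℝ) : K) := by
    push_cast; exact RCLike.mul_conj _
  rw [this, RCLike.ofReal_re]

lemma frobSq_nonneg {m n : Type*} [Fintype m] [Fintype n] (B : Matrix m n K) :
    0 ≤ frobSq B := by unfold frobSq; positivity

lemma frobSq_eq' {m n : Type*} [Fintype m] [Fintype n] (B : Matrix m n K) :
    frobSq B = RCLike.re (Bᴴ * B).trace := by
  rw [frobSq_eq, Matrix.trace_mul_comm]

/-- Regularised inverse of the first diagonal block. -/
def Hb (e : ℝ) (P : Matrix (p ⊕ r) (p ⊕ r) K) : Matrix p p K :=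
  (P.toBlocks₁₁ + (e : K) • (1 : Matrix p p K))⁻¹

lemma psd_of_proj {m : Type*} [Fintype m] {P : Matrix m m K} (h1 : Pᴴ = P) (h2 : P * P = P) :
    P.PosSemidef := by
  have := Matrix.posSemidef_conjTranspose_mul_self P
  rwa [h1, h2] at this

lemma psd_re_trace {m : Type*} [Fintype m] {P : Matrix m m K} (h : P.PosSemidef) :
    0 ≤ RCLike.re P.trace := (RCLike.nonneg_iff.1 h.trace_nonneg).1

variable {l : ℕ} {P : Matrix (p ⊕ r) (p ⊕ r) K}

lemma S_psd (hP : P ∈ PS K (p ⊕ r) l) : P.toBlocks₁₁.PosSemidef :=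
  (psd_of_proj hP.1 hP.2.1).submatrix Sum.inl

lemma S_psd' (hP : P ∈ PS K (p ⊕ r) l) : (1 - P.toBlocks₁₁).PosSemidef := by
  have : (1 - P).PosSemidef := by
    apply psd_of_proj
    · simp [hP.1]
    · simp [Matrix.mul_sub, Matrix.sub_mul, hP.2.1]
  have h2 := this.submatrix (Sum.inl : p → p ⊕ r)
  convert h2 using 1
  ext i j
  simp [Matrix.toBlocks₁₁, Matrix.one_apply]

lemma Se_posDef (hP : P ∈ PS K (p ⊕ r) l) {e : ℝ} (he : 0 < e) :
    (P.toBlocks₁₁ + (e : K) • (1 : Matrix p p K)).PosDef := by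
  refine Matrix.PosDef.posSemidef_add (S_psd hP) ?_
  refine Matrix.PosDef.smul Matrix.PosDef.one ?_
  exact_mod_cast he

lemma Se_unit (hP : P ∈ PS K (p ⊕ r) l) {e : ℝ} (he : 0 < e) :
    IsUnit (P.toBlocks₁₁ + (e : K) • (1 : Matrix p p K)).det :=
  (Matrix.isUnit_iff_isUnit_det _).1 (Se_posDef hP he).isUnit

lemma H_psd (hP : P ∈ PS K (p ⊕ r) l) {e : ℝ} (he : 0 < e) : (Hb e P).PosSemidef :=
  (Se_posDef hP he).inv.posSemidef

lemma H_herm (hP : P ∈ PS K (p ⊕ r) l) {e : ℝ} (he : 0 < e) : (Hb e P)ᴴ = Hb e P :=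
  (H_psd hP he).isHermitian

lemma HS (hP : P ∈ PS K (p ⊕ r) l) {e : ℝ} (he : 0 < e) :
    Hb e P * P.toBlocks₁₁ = 1 - (e : K) • Hb e P := by
  have := Matrix.nonsing_inv_mul _ (Se_unit hP he)
  rw [Matrix.mul_add, Matrix.mul_smul, Matrix.mul_one] at this
  exact eq_sub_of_add_eq this

lemma SH (hP : P ∈ PS K (p ⊕ r) l) {e : ℝ} (he : 0 < e) :
    P.toBlocks₁₁ * Hb e P = 1 - (e : K) • Hb e P := by
  have := Matrix.mul_nonsing_inv _ (Se_unit hP he)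
  rw [Matrix.add_mul, Matrix.smul_mul, Matrix.one_mul] at this
  exact eq_sub_of_add_eq this

lemma block21 (hP : P ∈ PS K (p ⊕ r) l) : P.toBlocks₂₁ = P.toBlocks₁₂ᴴ := by
  ext i j
  have := congrFun (congrFun hP.1 (Sum.inr i)) (Sum.inl j)
  simp only [Matrix.conjTranspose_apply] at this
  simp [Matrix.toBlocks₂₁, Matrix.toBlocks₁₂, this]

lemma TT (hP : P ∈ PS K (p ⊕ r) l) :
    P.toBlocks₁₂ * P.toBlocks₁₂ᴴ = P.toBlocks₁₁ - P.toBlocks₁₁ * P.toBlocks₁₁ := by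
  rw [← block21 hP]
  have h := hP.2.1
  rw [← Matrix.fromBlocks_toBlocks P, Matrix.fromBlocks_multiply] at h
  have h2 := congrArg Matrix.toBlocks₁₁ h
  simp only [Matrix.toBlocks_fromBlocks₁₁] at h2
  exact eq_sub_of_add_eq' h2

lemma trW (hP : P ∈ PS K (p ⊕ r) l) :
    P.toBlocks₂₂.trace = (l : K) - P.toBlocks₁₁.trace := by
  have h := hP.2.2
  have h' : P.trace = P.toBlocks₁₁.trace + P.toBlocks₂₂.trace := by
    simp [Matrix.trace, Matrix.toBlocks₁₁, Matrix.toBlocks₂₂]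
  rw [h'] at h
  exact eq_sub_of_add_eq' h

/-- The linear part of the divergence. -/
def Lb (e : ℝ) (P : Matrix (p ⊕ r) (p ⊕ r) K) : K :=
  (Hb e P).trace * (P.toBlocks₂₂.trace - (P.toBlocks₁₂ᴴ * Hb e P * P.toBlocks₁₂).trace)
    - (Fintype.card r : K) * (Hb e P * P.toBlocks₁₁).trace

lemma y_eq (hP : P ∈ PS K (p ⊕ r) l) {e : ℝ} (he : 0 < e) :
    RCLike.re (Hb e P * P.toBlocks₁₁).trace
      = Fintype.card p - e * RCLike.re (Hb e P).trace := by
  rw [HS hP he, Matrix.trace_sub, Matrix.trace_smul, map_sub, smul_eq_mul, RCLike.re_ofReal_mul]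
  simp

lemma a_nonneg (hP : P ∈ PS K (p ⊕ r) l) {e : ℝ} (he : 0 < e) :
    0 ≤ RCLike.re (Hb e P).trace := psd_re_trace (H_psd hP he)

lemma y_le (hP : P ∈ PS K (p ⊕ r) l) {e : ℝ} (he : 0 < e) :
    RCLike.re (Hb e P * P.toBlocks₁₁).trace ≤ Fintype.card p := by
  rw [y_eq hP he]
  nlinarith [a_nonneg hP he]

lemma b2_nonneg (hP : P ∈ PS K (p ⊕ r) l) {e : ℝ} (he : 0 < e) :
    0 ≤ RCLike.re (Hb e P * (1 - P.toBlocks₁₁) * Hb e P).trace := by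
  have := (S_psd' hP).mul_mul_conjTranspose_same (Hb e P)
  rw [H_herm hP he] at this
  exact psd_re_trace this

lemma N_eq (hP : P ∈ PS K (p ⊕ r) l) {e : ℝ} (he : 0 < e) :
    frobSq (Hb e P * P.toBlocks₁₂) = RCLike.re (Hb e P).trace
      - RCLike.re (Hb e P * P.toBlocks₁₁).trace
      - e * RCLike.re (Hb e P * (1 - P.toBlocks₁₁) * Hb e P).trace := by
  have h1 : Hb e P * P.toBlocks₁₂ * (Hb e P * P.toBlocks₁₂)ᴴ
      = Hb e P - P.toBlocks₁₁ * Hb e P - (e : K) • (Hb e P * (1 - P.toBlocks₁₁) * Hb e P) := by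
    rw [Matrix.conjTranspose_mul, H_herm hP he]
    calc Hb e P * P.toBlocks₁₂ * (P.toBlocks₁₂ᴴ * Hb e P)
        = Hb e P * (P.toBlocks₁₂ * P.toBlocks₁₂ᴴ) * Hb e P := by simp only [Matrix.mul_assoc]
      _ = (Hb e P * P.toBlocks₁₁) * (1 - P.toBlocks₁₁) * Hb e P := by
          rw [TT hP]; noncomm_ring
      _ = _ := by
          rw [HS hP he]
          simp only [Matrix.sub_mul, Matrix.mul_sub, Matrix.smul_mul, Matrix.one_mul,
            Matrix.mul_one, smul_sub]
          abel
  rw [frobSq_eq, h1]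
  simp only [Matrix.trace_sub, Matrix.trace_smul, map_sub, smul_eq_mul, RCLike.re_ofReal_mul]
  rw [Matrix.trace_mul_comm P.toBlocks₁₁]

lemma N_le (hP : P ∈ PS K (p ⊕ r) l) {e : ℝ} (he : 0 < e) :
    frobSq (Hb e P * P.toBlocks₁₂) ≤ RCLike.re (Hb e P).trace
      - RCLike.re (Hb e P * P.toBlocks₁₁).trace := by
  rw [N_eq hP he]
  nlinarith [b2_nonneg hP he]

lemma L_ge (hP : P ∈ PS K (p ⊕ r) l) {e : ℝ} (he : 0 < e) :
    ((l : ℝ) - Fintype.card p) * RCLike.re (Hb e P).trace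
      - Fintype.card r * RCLike.re (Hb e P * P.toBlocks₁₁).trace ≤ RCLike.re (Lb e P) := by
  have h1 : (P.toBlocks₁₂ᴴ * Hb e P * P.toBlocks₁₂).trace
      = (Fintype.card p : K) - P.toBlocks₁₁.trace
        - (e : K) * ((Hb e P).trace - (Hb e P * P.toBlocks₁₁).trace) := by
    rw [Matrix.mul_assoc, Matrix.trace_mul_comm, Matrix.mul_assoc, TT hP]
    have : Hb e P * (P.toBlocks₁₁ - P.toBlocks₁₁ * P.toBlocks₁₁)
       = (Hb e P * P.toBlocks₁₁) * (1 - P.toBlocks₁₁) := by noncomm_ring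
    rw [this, HS hP he]
    nth_rewrite 1 [Matrix.sub_mul]
    rw [Matrix.smul_mul, Matrix.mul_sub (Hb e P), HS hP he, Matrix.one_mul, Matrix.mul_one]
    simp only [Matrix.trace_sub, Matrix.trace_smul, Matrix.trace_one, smul_eq_mul]
  have him : RCLike.im (Hb e P).trace = 0 := by
    rw [← RCLike.conj_eq_iff_im]
    have := Matrix.trace_conjTranspose (Hb e P)
    rw [H_herm hP he] at this
    exact this.symm
  have hb : 0 ≤ RCLike.re (Hb e P).trace - RCLike.re (Hb e P * P.toBlocks₁₁).trace := by
    have := N_le hP he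
    linarith [frobSq_nonneg (Hb e P * P.toBlocks₁₂)]
  have ha := a_nonneg hP he
  have h2 : Lb e P = (Hb e P).trace * (((l : ℝ) - (Fintype.card p : ℝ) : ℝ) +
      (e : K) * ((Hb e P).trace - (Hb e P * P.toBlocks₁₁).trace))
      - ((Fintype.card r : ℝ) : K) * (Hb e P * P.toBlocks₁₁).trace := by
    rw [Lb, h1, trW hP]; push_cast; ring
  rw [h2, map_sub, RCLike.mul_re, him, zero_mul, sub_zero, RCLike.re_ofReal_mul, map_add,
    RCLike.ofReal_re, RCLike.re_ofReal_mul, map_sub]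
  have := mul_nonneg (mul_nonneg ha he.le) hb
  nlinarith

lemma eH_le (hP : P ∈ PS K (p ⊕ r) l) {e : ℝ} (he : 0 < e) :
    frobSq ((e : K) • Hb e P) ≤ e * RCLike.re (Hb e P).trace := by
  have h0 : 0 ≤ RCLike.re (Hb e P * P.toBlocks₁₁ * Hb e P).trace := by
    have := (S_psd hP).mul_mul_conjTranspose_same (Hb e P)
    rw [H_herm hP he] at this
    exact psd_re_trace this
  rw [HS hP he, Matrix.sub_mul, Matrix.one_mul, Matrix.smul_mul, Matrix.trace_sub,
    Matrix.trace_smul, map_sub, smul_eq_mul, RCLike.re_ofReal_mul] at h0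
  rw [frobSq_eq, Matrix.conjTranspose_smul, H_herm hP he, Matrix.smul_mul, Matrix.mul_smul,
    Matrix.trace_smul, Matrix.trace_smul]
  simp only [smul_eq_mul, RCLike.re_ofReal_mul, RCLike.star_def, RCLike.conj_ofReal]
  nlinarith

end blocks

section diverg
variable {K : Type*} [RCLike K] {p r : Type*} [Fintype p] [DecidableEq p] [Fintype r] [DecidableEq r]
variable {l : ℕ}

lemma Hb_cont {e : ℝ} (he : 0 < e) : ContinuousOn (Hb (K := K) (p := p) (r := r) e)
    (PS K (p ⊕ r) l) := by
  intro P hP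
  apply ContinuousAt.continuousWithinAt
  have h1 : ContinuousAt (fun P : Matrix (p ⊕ r) (p ⊕ r) K =>
      P.toBlocks₁₁ + (e : K) • (1 : Matrix p p K)) P := by
    apply Continuous.continuousAt
    have : Continuous (fun P : Matrix (p ⊕ r) (p ⊕ r) K => P.toBlocks₁₁) :=
      continuous_id.matrix_submatrix _ _
    fun_prop
  refine ContinuousAt.comp (f := fun P : Matrix (p ⊕ r) (p ⊕ r) K =>
      P.toBlocks₁₁ + (e : K) • (1 : Matrix p p K)) (g := fun A => A⁻¹)
      (continuousAt_matrix_inv _ ?_) h1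
  simpa [Ring.inverse_eq_inv'] using continuousAt_inv₀ (Se_unit hP he).ne_zero

lemma cont11 : Continuous (fun P : Matrix (p ⊕ r) (p ⊕ r) K => P.toBlocks₁₁) :=
  continuous_id.matrix_submatrix _ _
lemma cont12 : Continuous (fun P : Matrix (p ⊕ r) (p ⊕ r) K => P.toBlocks₁₂) :=
  continuous_id.matrix_submatrix _ _
lemma cont22 : Continuous (fun P : Matrix (p ⊕ r) (p ⊕ r) K => P.toBlocks₂₂) :=
  continuous_id.matrix_submatrix _ _

lemma contOn_mul {Y : Type*} [TopologicalSpace Y] {a b c : Type*} [Fintype b] {s : Set Y}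
    {f : Y → Matrix a b K} {g : Y → Matrix b c K} (hf : ContinuousOn f s) (hg : ContinuousOn g s) :
    ContinuousOn (fun y => f y * g y) s := by
  rw [continuousOn_iff_continuous_domRestrict] at *
  exact Continuous.matrix_mul hf hg

lemma contOn_trace {Y : Type*} [TopologicalSpace Y] {a : Type*} [Fintype a] {s : Set Y}
    {f : Y → Matrix a a K} (hf : ContinuousOn f s) :
    ContinuousOn (fun y => (f y).trace) s := by
  rw [continuousOn_iff_continuous_domRestrict] at *
  exact Continuous.matrix_trace hf

lemma contOn_star {Y : Type*} [TopologicalSpace Y] {a b : Type*} {s : Set Y}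
    {f : Y → Matrix a b K} (hf : ContinuousOn f s) :
    ContinuousOn (fun y => (f y)ᴴ) s := by
  rw [continuousOn_iff_continuous_domRestrict] at *
  exact Continuous.matrix_conjTranspose hf

lemma contOn_entry {Y : Type*} [TopologicalSpace Y] {a b : Type*} {s : Set Y}
    {f : Y → Matrix a b K} (hf : ContinuousOn f s) (i : a) (j : b) :
    ContinuousOn (fun y => f y i j) s := by
  rw [continuousOn_iff_continuous_domRestrict] at *
  exact Continuous.matrix_elem hf i j

lemma contOn_re {Y : Type*} [TopologicalSpace Y] {s : Set Y}
    {f : Y → K} (hf : ContinuousOn f s) : ContinuousOn (fun y => RCLike.re (f y)) s :=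
  RCLike.continuous_re.comp_continuousOn hf

lemma contOn_frobSq {Y : Type*} [TopologicalSpace Y] {a b : Type*} [Fintype a] [Fintype b]
    {s : Set Y} {f : Y → Matrix a b K} (hf : ContinuousOn f s) :
    ContinuousOn (fun y => frobSq (f y)) s := by
  unfold frobSq
  exact continuousOn_finsetSum _ fun i _ => continuousOn_finsetSum _ fun j _ =>
    ((contOn_entry hf i j).norm).pow 2

/-- Test function. -/
def gZ (e : ℝ) (Z : Matrix p r K) (P : Matrix (p ⊕ r) (p ⊕ r) K) : ℝ :=
  RCLike.re (Zᴴ * (Hb e P * P.toBlocks₁₂)).trace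

/-- Its derivative. -/
def DZ (e : ℝ) (Z : Matrix p r K) (P : Matrix (p ⊕ r) (p ⊕ r) K) : ℝ :=
  RCLike.re (Zᴴ * (-(Hb e P * (Z * P.toBlocks₁₂ᴴ + P.toBlocks₁₂ * Zᴴ) * Hb e P) * P.toBlocks₁₂
    + Hb e P * (Z * P.toBlocks₂₂ - P.toBlocks₁₁ * Z))).trace

lemma gZ_cont {e : ℝ} (he : 0 < e) (Z : Matrix p r K) : ContinuousOn (gZ e Z) (PS K (p ⊕ r) l) :=
  contOn_re (contOn_trace (contOn_mul continuousOn_const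
    (contOn_mul (Hb_cont he) cont12.continuousOn)))

lemma DZ_cont {e : ℝ} (he : 0 < e) (Z : Matrix p r K) : ContinuousOn (DZ e Z) (PS K (p ⊕ r) l) := by
  have hH := Hb_cont (K := K) (p := p) (r := r) (l := l) he
  have h11 := (cont11 (K := K) (p := p) (r := r)).continuousOn (s := PS K (p ⊕ r) l)
  have h12 := (cont12 (K := K) (p := p) (r := r)).continuousOn (s := PS K (p ⊕ r) l)
  have h22 := (cont22 (K := K) (p := p) (r := r)).continuousOn (s := PS K (p ⊕ r) l)
  have hZ : ContinuousOn (fun _ : Matrix (p ⊕ r) (p ⊕ r) K => Z) (PS K (p ⊕ r) l) :=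
    continuousOn_const
  exact contOn_re (contOn_trace (contOn_mul (contOn_star hZ) (ContinuousOn.add
    (contOn_mul (ContinuousOn.neg (contOn_mul (contOn_mul hH ((contOn_mul hZ (contOn_star h12)).add
      (contOn_mul h12 (contOn_star hZ)))) hH)) h12)
    (contOn_mul hH ((contOn_mul hZ h22).sub (contOn_mul h11 hZ))))))

lemma DZ_deriv {e : ℝ} (he : 0 < e) (Z : Matrix p r K) {P : Matrix (p ⊕ r) (p ⊕ r) K}
    (hP : P ∈ PS K (p ⊕ r) l) :
    HasDerivAt (fun t => gZ e Z (Ut (fromBlocks 0 Z (-Zᴴ) 0) t * P *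
      (Ut (fromBlocks 0 Z (-Zᴴ) 0) t)ᴴ)) (DZ e Z P) 0 := by
  set X : Matrix (p ⊕ r) (p ⊕ r) K := fromBlocks 0 Z (-Zᴴ) 0 with hX
  have hU := Ut_md X
  have h1 := (hU.mul (MD.const P 0)).mul hU.conjTranspose
  have h0 : Ut X 0 * P * (Ut X 0)ᴴ = P := by simp [Ut_zero]
  simp only [Ut_zero, Matrix.mul_zero, add_zero, Matrix.conjTranspose_one, Matrix.mul_one,
    Matrix.one_mul] at h1
  have hder : X * P + P * Xᴴ = fromBlocks (Z * P.toBlocks₁₂ᴴ + P.toBlocks₁₂ * Zᴴ)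
      (Z * P.toBlocks₂₂ - P.toBlocks₁₁ * Z)
      (-(Zᴴ * P.toBlocks₁₁) + P.toBlocks₂₂ * Zᴴ)
      (-(Zᴴ * P.toBlocks₁₂) - P.toBlocks₁₂ᴴ * Z) := by
    conv_lhs => rw [← Matrix.fromBlocks_toBlocks P, block21 hP]
    simp [hX, Matrix.fromBlocks_conjTranspose, Matrix.fromBlocks_multiply, Matrix.fromBlocks_add,
      sub_eq_add_neg]
  rw [hder] at h1
  set Pt := fun t => Ut X t * P * (Ut X t)ᴴ with hPt
  have h11 : MD (fun t => (Pt t).toBlocks₁₁) (Z * P.toBlocks₁₂ᴴ + P.toBlocks₁₂ * Zᴴ) 0 :=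
    fun i j => h1 (Sum.inl i) (Sum.inl j)
  have h12 : MD (fun t => (Pt t).toBlocks₁₂) (Z * P.toBlocks₂₂ - P.toBlocks₁₁ * Z) 0 :=
    fun i j => h1 (Sum.inl i) (Sum.inr j)
  have h2 := (h11.add (MD.const ((e : K) • (1 : Matrix p p K)) 0)).inv
    (by simp only [hPt, h0]; exact Se_unit hP he)
  have h3 := ((MD.const Zᴴ 0).mul (h2.mul h12)).trace
  have h4 := (RCLike.reCLM (K := K)).hasFDerivAt.comp_hasDerivAt (0 : ℝ) h3
  have hp0 : Pt 0 = P := h0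
  rw [hp0] at h4
  simp only [add_zero, Matrix.zero_mul, zero_add] at h4
  exact h4

lemma stein_Z [MeasurableSpace K] [BorelSpace K] {ν : Measure (Matrix (p ⊕ r) (p ⊕ r) K)}
    (h : InvLaw l ν) {e : ℝ} (he : 0 < e) (Z : Matrix p r K) : ∫ P, DZ e Z P ∂ν = 0 :=
  h.stein (gZ_cont he Z) (DZ_cont he Z) (by simp [Matrix.fromBlocks_conjTranspose,
    Matrix.fromBlocks_neg]) (fun _ hP => DZ_deriv he Z hP)

/-- Sum of squares of the entries of `H T`. -/
def Qb (e : ℝ) (P : Matrix (p ⊕ r) (p ⊕ r) K) : K := ∑ i, ∑ j, (Hb e P * P.toBlocks₁₂) i j ^ 2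

lemma tr_single (i : p) (j : r) (c : K) (A : Matrix p r K) :
    ((Matrix.single i j c)ᴴ * A).trace = star c * A i j := by
  simp [Matrix.trace, Matrix.mul_apply, Matrix.single_apply, Matrix.conjTranspose_apply, ite_and]

lemma mul_single_mul {a b : Type*} [Fintype a] (i : p) (j : r) (c : K)
    (A : Matrix a p K) (B : Matrix r b K)
    (x : a) (y : b) : (A * Matrix.single i j c * B) x y = c * (A x i * B j y) := by
  simp [Matrix.mul_apply, Matrix.single_apply, ite_and, Finset.sum_ite_eq, Finset.sum_ite_eq']
  ring

lemma DZ_single (e : ℝ) (c : K) (i : p) (j : r) (P : Matrix (p ⊕ r) (p ⊕ r) K) :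
    DZ e (Matrix.single i j c) P = RCLike.re (
      star c * c * (Hb e P i i * P.toBlocks₂₂ j j -
        Hb e P i i * (P.toBlocks₁₂ᴴ * Hb e P * P.toBlocks₁₂) j j -
        (Hb e P * P.toBlocks₁₁) i i) - star c ^ 2 * (Hb e P * P.toBlocks₁₂) i j ^ 2) := by
  rw [DZ]
  set H := Hb e P
  set S := P.toBlocks₁₁
  set T := P.toBlocks₁₂
  set W := P.toBlocks₂₂
  set Z := Matrix.single i j c with hZ
  have : -(H * (Z * Tᴴ + T * Zᴴ) * H) * T + H * (Z * W - S * Z)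
      = -(H * Z * (Tᴴ * H * T)) - (H * T) * Zᴴ * (H * T) + H * Z * W
        - (H * S) * Z * (1 : Matrix r r K) := by
    simp only [Matrix.mul_add, Matrix.add_mul, Matrix.neg_mul, Matrix.mul_sub, Matrix.mul_assoc,
      Matrix.mul_one]
    abel
  have hs : Zᴴ = Matrix.single j i (star c) := by simp [hZ]
  rw [this, hZ, tr_single, ← hZ, hs]
  simp only [Matrix.add_apply, Matrix.sub_apply, Matrix.neg_apply, hZ]
  rw [mul_single_mul, mul_single_mul, mul_single_mul, mul_single_mul]
  congr 1
  simp
  ring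

lemma DZ_sum (e : ℝ) (c : K) (P : Matrix (p ⊕ r) (p ⊕ r) K) :
    ∑ i, ∑ j, DZ e (Matrix.single i j c) P
      = RCLike.re (star c * c * Lb e P - star c ^ 2 * Qb e P) := by
  simp only [DZ_single, ← map_sum]
  congr 1
  simp only [Finset.sum_sub_distrib, ← Finset.mul_sum, Lb, Qb, Matrix.trace, Matrix.diag,
    mul_sub, Finset.sum_mul_sum, Finset.sum_const, Finset.card_univ, nsmul_eq_mul]
  
lemma Lb_cont {e : ℝ} (he : 0 < e) : ContinuousOn (Lb (K := K) (p := p) (r := r) e)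
    (PS K (p ⊕ r) l) := by
  have hH := Hb_cont (K := K) (p := p) (r := r) (l := l) he
  have h11 := (cont11 (K := K) (p := p) (r := r)).continuousOn (s := PS K (p ⊕ r) l)
  have h12 := (cont12 (K := K) (p := p) (r := r)).continuousOn (s := PS K (p ⊕ r) l)
  have h22 := (cont22 (K := K) (p := p) (r := r)).continuousOn (s := PS K (p ⊕ r) l)
  exact ((contOn_trace hH).mul ((contOn_trace h22).sub
    (contOn_trace (contOn_mul (contOn_mul (contOn_star h12) hH) h12)))).sub
    (continuousOn_const.mul (contOn_trace (contOn_mul hH h11)))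

lemma Qb_cont {e : ℝ} (he : 0 < e) : ContinuousOn (Qb (K := K) (p := p) (r := r) e)
    (PS K (p ⊕ r) l) :=
  continuousOn_finsetSum _ fun i _ => continuousOn_finsetSum _ fun j _ =>
    (contOn_entry (contOn_mul (Hb_cont he) cont12.continuousOn) i j).pow 2

variable [MeasurableSpace K] [BorelSpace K] {ν : Measure (Matrix (p ⊕ r) (p ⊕ r) K)}

lemma div_zero (h : InvLaw l ν) {e : ℝ} (he : 0 < e) (c : K) :
    ∫ P, RCLike.re (star c * c * Lb e P - star c ^ 2 * Qb e P) ∂ν = 0 := by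
  simp only [← DZ_sum]
  rw [integral_finsetSum _ fun i _ => integrable_finsetSum _ fun j _ => h.integrable (DZ_cont he _)]
  refine Finset.sum_eq_zero fun i _ => ?_
  rw [integral_finsetSum _ fun j _ => h.integrable (DZ_cont he _)]
  exact Finset.sum_eq_zero fun j _ => stein_Z h he _

lemma Qb_le (e : ℝ) (P : Matrix (p ⊕ r) (p ⊕ r) K) :
    RCLike.re (Qb e P) ≤ frobSq (Hb e P * P.toBlocks₁₂) := by
  simp only [Qb, frobSq, map_sum]
  refine Finset.sum_le_sum fun i _ => Finset.sum_le_sum fun j _ => ?_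
  exact (RCLike.re_le_norm _).trans (by rw [norm_pow])

lemma L_int_le (h : InvLaw l ν) {e : ℝ} (he : 0 < e) :
    ∫ P, RCLike.re (Lb e P) ∂ν ≤ alphaK K * ∫ P, frobSq (Hb e P * P.toBlocks₁₂) ∂ν := by
  have hL : Integrable (fun P => RCLike.re (Lb e P)) ν := h.integrable (contOn_re (Lb_cont he))
  have hQ : Integrable (fun P => RCLike.re (Qb e P)) ν := h.integrable (contOn_re (Qb_cont he))
  have h1 := div_zero h he (1 : K)
  simp only [star_one, one_mul, one_pow, map_sub] at h1
  rw [integral_sub hL hQ] at h1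
  by_cases hI : (RCLike.I : K) = 0
  · rw [alphaK, if_pos hI, one_mul]
    have : ∫ P, RCLike.re (Qb e P) ∂ν ≤ ∫ P, frobSq (Hb e P * P.toBlocks₁₂) ∂ν :=
      integral_mono hQ (h.integrable (contOn_frobSq (contOn_mul (Hb_cont he) cont12.continuousOn)))
        (fun P => Qb_le e P)
    linarith
  · rw [alphaK, if_neg hI, zero_mul]
    have h2 := div_zero h he (RCLike.I : K)
    have hII : (RCLike.I : K) * RCLike.I = -1 := RCLike.I_mul_I_of_nonzero hI
    have e1 : star (RCLike.I : K) * RCLike.I = 1 := by simp [hII]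
    have e2 : star (RCLike.I : K) ^ 2 = -1 := by simp [pow_two, hII]
    simp only [e1, e2, one_mul, neg_mul, sub_neg_eq_add, map_add] at h2
    rw [integral_add hL hQ] at h2
    linarith

/-- Main moment estimates. -/
lemma moments (h : InvLaw l ν) {e : ℝ} (he : 0 < e) (hln : l ≤ Fintype.card p + Fintype.card r)
    (hq : (Fintype.card p : ℝ) < l - alphaK K) :
    ((l : ℝ) - Fintype.card p - alphaK K) * ∫ P, frobSq (Hb e P * P.toBlocks₁₂) ∂ν
      ≤ Fintype.card p * (Fintype.card p + Fintype.card r - l) ∧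
    ((l : ℝ) - Fintype.card p - alphaK K) * ∫ P, RCLike.re (Hb e P).trace ∂ν
      ≤ Fintype.card p * Fintype.card r := by
  have := h.prob
  have hL : Integrable (fun P => RCLike.re (Lb e P)) ν := h.integrable (contOn_re (Lb_cont he))
  have ha : Integrable (fun P => RCLike.re (Hb e P).trace) ν :=
    h.integrable (contOn_re (contOn_trace (Hb_cont he)))
  have hy : Integrable (fun P => RCLike.re (Hb e P * P.toBlocks₁₁).trace) ν :=
    h.integrable (contOn_re (contOn_trace (contOn_mul (Hb_cont he) cont11.continuousOn)))
  have hN : Integrable (fun P => frobSq (Hb e P * P.toBlocks₁₂)) ν :=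
    h.integrable (contOn_frobSq (contOn_mul (Hb_cont he) cont12.continuousOn))
  have i1 := L_int_le h he
  have i2 : ((l : ℝ) - Fintype.card p) * ∫ P, RCLike.re (Hb e P).trace ∂ν
      - Fintype.card r * ∫ P, RCLike.re (Hb e P * P.toBlocks₁₁).trace ∂ν
      ≤ ∫ P, RCLike.re (Lb e P) ∂ν := by
    rw [← integral_const_mul, ← integral_const_mul, ← integral_sub (ha.const_mul _) (hy.const_mul _)]
    refine integral_mono_ae ((ha.const_mul _).sub (hy.const_mul _)) hL ?_
    filter_upwards [h.mem] with P hP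
    exact L_ge hP he
  have i3 : ∫ P, frobSq (Hb e P * P.toBlocks₁₂) ∂ν ≤ ∫ P, RCLike.re (Hb e P).trace ∂ν
      - ∫ P, RCLike.re (Hb e P * P.toBlocks₁₁).trace ∂ν := by
    rw [← integral_sub ha hy]
    refine integral_mono_ae hN (ha.sub hy) ?_
    filter_upwards [h.mem] with P hP
    exact N_le hP he
  have i4 : ∫ P, RCLike.re (Hb e P * P.toBlocks₁₁).trace ∂ν ≤ Fintype.card p := by
    have : ∫ P, RCLike.re (Hb e P * P.toBlocks₁₁).trace ∂ν ≤ ∫ _, (Fintype.card p : ℝ) ∂ν := by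
      refine integral_mono_ae hy (integrable_const _) ?_
      filter_upwards [h.mem] with P hP
      exact y_le hP he
    simpa using this
  have i5 : 0 ≤ ∫ P, RCLike.re (Hb e P).trace ∂ν := by
    refine integral_nonneg_of_ae ?_
    filter_upwards [h.mem] with P hP
    exact a_nonneg hP he
  have i6 : 0 ≤ ∫ P, frobSq (Hb e P * P.toBlocks₁₂) ∂ν :=
    integral_nonneg fun P => frobSq_nonneg _
  generalize ∫ P, frobSq (Hb e P * P.toBlocks₁₂) ∂ν = N at *
  generalize ∫ P, RCLike.re (Hb e P).trace ∂ν = a at *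
  generalize ∫ P, RCLike.re (Hb e P * P.toBlocks₁₁).trace ∂ν = y at *
  generalize ∫ P, RCLike.re (Lb e P) ∂ν = L at *
  have hα : 0 ≤ alphaK K ∧ alphaK K ≤ 1 := by unfold alphaK; split_ifs <;> norm_num
  obtain ⟨hα0, hα1⟩ := hα
  have hln' : (l : ℝ) ≤ Fintype.card p + Fintype.card r := by exact_mod_cast hln
  generalize (l : ℝ) = lr at *
  have hp0 : (0 : ℝ) ≤ Fintype.card p := by positivity
  have hr0 : (0 : ℝ) ≤ Fintype.card r := by positivity
  generalize (Fintype.card p : ℝ) = q at *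
  generalize (Fintype.card r : ℝ) = k at *
  generalize alphaK K = α at *
  have j1 : (lr - q - α) * a ≤ (k - α) * y := by nlinarith [mul_le_mul_of_nonneg_left i3 hα0]
  have hkα : 0 ≤ k - α := by linarith
  constructor
  · have j2 : (lr - q - α) * N ≤ (lr - q - α) * (a - y) :=
      mul_le_mul_of_nonneg_left i3 (by linarith)
    have j3 : (q + k - lr) * y ≤ (q + k - lr) * q := mul_le_mul_of_nonneg_left i4 (by linarith)
    nlinarith
  · have j3 : (k - α) * y ≤ (k - α) * q := mul_le_mul_of_nonneg_left i4 hkα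
    nlinarith [mul_nonneg hα0 hp0]

end diverg

section symm
variable {K : Type*} [RCLike K] {p r : Type*} [Fintype p] [DecidableEq p] [Fintype r] [DecidableEq r]
variable {l : ℕ}

/-- The matrix `Tᴴ H² T`. -/
def Fb (e : ℝ) (P : Matrix (p ⊕ r) (p ⊕ r) K) : Matrix r r K :=
  P.toBlocks₁₂ᴴ * Hb e P * (Hb e P * P.toBlocks₁₂)

lemma Fb_cont {e : ℝ} (he : 0 < e) : ContinuousOn (Fb (K := K) (p := p) (r := r) e)
    (PS K (p ⊕ r) l) :=
  contOn_mul (contOn_mul (contOn_star cont12.continuousOn) (Hb_cont he))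
    (contOn_mul (Hb_cont he) cont12.continuousOn)

lemma block_unitary {D : Matrix r r K} (hD : D ∈ Matrix.unitaryGroup r K) :
    fromBlocks (1 : Matrix p p K) 0 0 D ∈ Matrix.unitaryGroup (p ⊕ r) K := by
  rw [Matrix.mem_unitaryGroup_iff, Matrix.star_eq_conjTranspose] at *
  simp [Matrix.fromBlocks_conjTranspose, Matrix.fromBlocks_multiply, hD]

lemma Fb_conj (e : ℝ) (D : Matrix r r K) (P : Matrix (p ⊕ r) (p ⊕ r) K) :
    Fb e (fromBlocks (1 : Matrix p p K) 0 0 D * P * (fromBlocks (1 : Matrix p p K) 0 0 D)ᴴ)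
      = D * Fb e P * Dᴴ := by
  have h1 : fromBlocks (1 : Matrix p p K) 0 0 D * P * (fromBlocks (1 : Matrix p p K) 0 0 D)ᴴ
      = fromBlocks P.toBlocks₁₁ (P.toBlocks₁₂ * Dᴴ) (D * P.toBlocks₂₁)
        (D * P.toBlocks₂₂ * Dᴴ) := by
    conv_lhs => rw [← Matrix.fromBlocks_toBlocks P]
    simp [Matrix.fromBlocks_conjTranspose, Matrix.fromBlocks_multiply]
  rw [h1]
  simp [Fb, Hb, Matrix.mul_assoc]

lemma frob_BTH {d : Type*} [Fintype d] (B : Matrix d r K) {e : ℝ} (he : 0 < e)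
    {P : Matrix (p ⊕ r) (p ⊕ r) K} (hP : P ∈ PS K (p ⊕ r) l) :
    frobSq (B * P.toBlocks₁₂ᴴ * Hb e P) = RCLike.re (∑ k, ∑ j, (Bᴴ * B) k j * Fb e P j k) := by
  have : (∑ k, ∑ j, (Bᴴ * B) k j * Fb e P j k) = ((Bᴴ * B) * Fb e P).trace := by
    simp only [Matrix.trace, Matrix.diag, Matrix.mul_apply (M := Bᴴ * B)]
  rw [this, frobSq_eq]
  congr 1
  rw [Matrix.conjTranspose_mul, Matrix.conjTranspose_mul, Matrix.conjTranspose_conjTranspose,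
    H_herm hP he, Fb, Matrix.mul_assoc Bᴴ B, Matrix.trace_mul_comm Bᴴ]
  simp only [Matrix.mul_assoc]

variable [MeasurableSpace K] [BorelSpace K] {ν : Measure (Matrix (p ⊕ r) (p ⊕ r) K)}

lemma Fb_int (h : InvLaw l ν) {e : ℝ} (he : 0 < e) (j k : r) :
    Integrable (fun P => Fb e P j k) ν := h.integrable (contOn_entry (Fb_cont he) j k)

lemma Fb_inv (h : InvLaw l ν) {e : ℝ} (he : 0 < e) {D : Matrix r r K}
    (hD : D ∈ Matrix.unitaryGroup r K) (j k : r) :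
    ∫ P, (D * Fb e P * Dᴴ) j k ∂ν = ∫ P, Fb e P j k ∂ν := by
  rw [← h.integral_conj (contOn_entry (Fb_cont he) j k) (block_unitary hD)]
  simp only [Fb_conj]

lemma Fb_off (h : InvLaw l ν) {e : ℝ} (he : 0 < e) {j k : r} (hjk : j ≠ k) :
    ∫ P, Fb e P j k ∂ν = 0 := by
  have hD : (Matrix.diagonal (fun x => if x = j then (-1 : K) else 1)) ∈
      Matrix.unitaryGroup r K := by
    rw [Matrix.mem_unitaryGroup_iff, Matrix.star_eq_conjTranspose, Matrix.diagonal_conjTranspose,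
      Matrix.diagonal_mul_diagonal, ← Matrix.diagonal_one]
    congr 1
    funext x
    by_cases hx : x = j <;> simp [hx]
  have h1 := Fb_inv h he hD j k
  simp only [Matrix.diagonal_conjTranspose, Matrix.mul_diagonal, Matrix.diagonal_mul] at h1
  simp only [if_true, Pi.star_apply, if_neg hjk.symm, star_one, mul_one, neg_mul, one_mul] at h1
  rw [integral_neg] at h1
  exact self_eq_neg.1 h1.symm

lemma Fb_diag (h : InvLaw l ν) {e : ℝ} (he : 0 < e) (j k : r) :
    ∫ P, Fb e P j j ∂ν = ∫ P, Fb e P k k ∂ν := by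
  set s := Equiv.swap j k with hs
  have hmul : ∀ A : Matrix r r K, (1 : Matrix r r K).submatrix s id * A *
      ((1 : Matrix r r K).submatrix s id)ᴴ = A.submatrix s s := by
    intro A
    ext a b
    simp [Matrix.mul_apply, Matrix.one_apply, apply_ite]
  have hD : (1 : Matrix r r K).submatrix s id ∈ Matrix.unitaryGroup r K := by
    rw [Matrix.mem_unitaryGroup_iff, Matrix.star_eq_conjTranspose]
    have := hmul 1
    rw [Matrix.mul_one] at this
    rw [this]
    ext a b
    simp [Matrix.one_apply]
  have h1 := Fb_inv h he hD k k
  simp only [hmul, Matrix.submatrix_apply] at h1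
  simpa [hs] using h1

lemma symm_gen (h : InvLaw l ν) {e : ℝ} (he : 0 < e) {d : Type*} [Fintype d] (B : Matrix d r K) :
    ∫ P, frobSq (B * P.toBlocks₁₂ᴴ * Hb e P) ∂ν
      = RCLike.re (∑ j, (Bᴴ * B) j j * ∫ P, Fb e P j j ∂ν) := by
  have h1 : ∫ P, frobSq (B * P.toBlocks₁₂ᴴ * Hb e P) ∂ν
      = ∫ P, RCLike.re (∑ k, ∑ j, (Bᴴ * B) k j * Fb e P j k) ∂ν := by
    refine integral_congr_ae ?_
    filter_upwards [h.mem] with P hP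
    exact frob_BTH B he hP
  have hint : ∀ k j, Integrable (fun P => (Bᴴ * B) k j * Fb e P j k) ν :=
    fun k j => (Fb_int h he j k).const_mul _
  have hint2 : Integrable (fun P => ∑ k, ∑ j, (Bᴴ * B) k j * Fb e P j k) ν :=
    integrable_finsetSum _ fun k _ => integrable_finsetSum _ fun j _ => hint k j
  rw [h1, integral_re hint2,
    integral_finsetSum _ fun k _ => integrable_finsetSum _ fun j _ => hint k j]
  congr 1
  refine Finset.sum_congr rfl fun k _ => ?_
  rw [integral_finsetSum _ fun j _ => hint k j]
  rw [Finset.sum_eq_single k]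
  · rw [integral_const_mul]
  · intro j _ hj
    rw [integral_const_mul, Fb_off h he hj, mul_zero]
  · simp

lemma symm_int (h : InvLaw l ν) {e : ℝ} (he : 0 < e) {d : Type*} [Fintype d] (B : Matrix d r K) :
    Fintype.card r * ∫ P, frobSq (B * P.toBlocks₁₂ᴴ * Hb e P) ∂ν
      = frobSq B * ∫ P, frobSq (Hb e P * P.toBlocks₁₂) ∂ν := by
  have hN : ∫ P, frobSq (Hb e P * P.toBlocks₁₂) ∂ν
      = ∫ P, frobSq ((1 : Matrix r r K) * P.toBlocks₁₂ᴴ * Hb e P) ∂ν := by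
    refine integral_congr_ae ?_
    filter_upwards [h.mem] with P hP
    rw [frobSq_eq, frobSq_eq', Matrix.one_mul]
    simp [H_herm hP he]
  rw [hN, symm_gen h he, symm_gen h he]
  rcases isEmpty_or_nonempty r with hr | ⟨⟨j0⟩⟩
  · simp
  simp only [fun j => Fb_diag h he j j0, ← Finset.sum_mul]
  have htr : ∑ j, (Bᴴ * B) j j = ((frobSq B : ℝ) : K) := by
    have h2 : RCLike.im (Bᴴ * B).trace = 0 := by
      rw [← RCLike.conj_eq_iff_im]
      have := Matrix.trace_conjTranspose (Bᴴ * B)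
      rw [Matrix.conjTranspose_mul, Matrix.conjTranspose_conjTranspose] at this
      exact this.symm
    have h3 := RCLike.re_add_im (Bᴴ * B).trace
    rw [h2, ← frobSq_eq'] at h3
    simpa [Matrix.trace] using h3.symm
  have htr1 : ∑ j : r, ((1 : Matrix r r K)ᴴ * (1 : Matrix r r K) : Matrix r r K) j j = ((Fintype.card r : ℝ) : K) := by simp
  rw [htr, htr1, RCLike.re_ofReal_mul, RCLike.re_ofReal_mul]
  ring

end symm

section resid
variable {K : Type*} [RCLike K] {p r : Type*} [Fintype p] [DecidableEq p] [Fintype r] [DecidableEq r]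
variable {l : ℕ} {d : Type*} [Fintype d]

lemma frobSq_mul_le {a b c : Type*} [Fintype a] [Fintype b] [Fintype c]
    (A : Matrix a b K) (B : Matrix b c K) : frobSq (A * B) ≤ frobSq A * frobSq B := by
  unfold frobSq
  rw [Finset.sum_mul]
  refine Finset.sum_le_sum fun i _ => ?_
  rw [Finset.sum_comm (f := fun (x : b) (y : c) => ‖B x y‖ ^ 2), Finset.mul_sum]
  refine Finset.sum_le_sum fun j _ => ?_
  rw [Matrix.mul_apply]
  calc ‖∑ k, A i k * B k j‖ ^ 2 ≤ (∑ k, ‖A i k‖ * ‖B k j‖) ^ 2 := by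
        gcongr
        refine (norm_sum_le _ _).trans (le_of_eq ?_)
        simp
    _ ≤ _ := Finset.sum_mul_sq_le_sq_mul_sq _ _ _

lemma frobSq_sub_le {a b : Type*} [Fintype a] [Fintype b] (X Y : Matrix a b K) {s : ℝ}
    (hs : 0 < s) : frobSq (X - Y) ≤ (1 + s⁻¹) * frobSq X + (1 + s) * frobSq Y := by
  unfold frobSq
  simp only [Finset.mul_sum, ← Finset.sum_add_distrib]
  refine Finset.sum_le_sum fun i _ => Finset.sum_le_sum fun j _ => ?_
  have h1 := norm_sub_le (X i j) (Y i j)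
  rw [Matrix.sub_apply]
  generalize ‖X i j‖ = x at *
  generalize ‖Y i j‖ = y at *
  have h2 : ‖X i j - Y i j‖ ^ 2 ≤ (x + y) ^ 2 := by gcongr
  have h3 : 2 * (x * y) ≤ s⁻¹ * x ^ 2 + s * y ^ 2 := by
    have : s⁻¹ * x ^ 2 + s * y ^ 2 - 2 * (x * y) = s⁻¹ * (x - s * y) ^ 2 := by
      field_simp; ring
    have h4 : 0 ≤ s⁻¹ * (x - s * y) ^ 2 := by positivity
    linarith
  nlinarith

lemma frobSq_fromCols {a b c : Type*} [Fintype a] [Fintype b] [Fintype c] (X : Matrix a b K)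
    (Y : Matrix a c K) : frobSq (fromCols X Y) = frobSq X + frobSq Y := by
  simp [frobSq, Finset.sum_add_distrib]

/-- Right factor of the approximant. -/
def E1 (e : ℝ) (P : Matrix (p ⊕ r) (p ⊕ r) K) : Matrix (p ⊕ r) (p ⊕ r) K :=
  fromBlocks (Hb e P) 0 0 0

lemma resid_eq (A : Matrix d (p ⊕ r) K) {e : ℝ} (he : 0 < e)
    {P : Matrix (p ⊕ r) (p ⊕ r) K} (hP : P ∈ PS K (p ⊕ r) l) :
    frobSq (A - A * P * E1 e P) = frobSq (A.toCols₁ * ((e : K) • Hb e P)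
      - A.toCols₂ * P.toBlocks₁₂ᴴ * Hb e P) + frobSq A.toCols₂ := by
  rw [← frobSq_fromCols]
  congr 1
  have h1 : P * E1 e P = fromBlocks (P.toBlocks₁₁ * Hb e P) 0 (P.toBlocks₁₂ᴴ * Hb e P) 0 := by
    conv_lhs => rw [← Matrix.fromBlocks_toBlocks P, block21 hP]
    simp [E1, Matrix.fromBlocks_multiply, Hb]
  rw [Matrix.mul_assoc, h1, SH hP he]
  conv_lhs => rw [← Matrix.fromCols_toCols A, Matrix.fromCols_mul_fromBlocks]
  ext i (j | j)
  · simp [Matrix.mul_sub, Matrix.mul_assoc]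
    ring
  · simp

lemma resid_le (A : Matrix d (p ⊕ r) K) {e : ℝ} (he : 0 < e)
    {P : Matrix (p ⊕ r) (p ⊕ r) K} (hP : P ∈ PS K (p ⊕ r) l) {s : ℝ} (hs : 0 < s) :
    frobSq (A - A * P * E1 e P) ≤ frobSq A.toCols₂
      + (1 + s⁻¹) * (frobSq A.toCols₁ * (e * RCLike.re (Hb e P).trace))
      + (1 + s) * frobSq (A.toCols₂ * P.toBlocks₁₂ᴴ * Hb e P) := by
  rw [resid_eq A he hP]
  have h1 := frobSq_sub_le (A.toCols₁ * ((e : K) • Hb e P)) (A.toCols₂ * P.toBlocks₁₂ᴴ * Hb e P) hs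
  have h2 := (frobSq_mul_le A.toCols₁ ((e : K) • Hb e P)).trans
    (mul_le_mul_of_nonneg_left (eH_le hP he) (frobSq_nonneg _))
  have h3 : 0 ≤ 1 + s⁻¹ := by positivity
  have := mul_le_mul_of_nonneg_left h2 h3
  linarith

variable [MeasurableSpace K] [BorelSpace K] {ν : Measure (Matrix (p ⊕ r) (p ⊕ r) K)}

lemma E1_cont {e : ℝ} (he : 0 < e) (A : Matrix d (p ⊕ r) K) :
    ContinuousOn (fun P => frobSq (A - A * P * E1 e P)) (PS K (p ⊕ r) l) := by
  have h1 : ContinuousOn (E1 (K := K) (p := p) (r := r) e) (PS K (p ⊕ r) l) := by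
    have hH := Hb_cont (K := K) (p := p) (r := r) (l := l) he
    rw [continuousOn_iff_continuous_domRestrict] at *
    exact Continuous.matrix_fromBlocks hH continuous_const continuous_const continuous_const
  exact contOn_frobSq (continuousOn_const.sub (contOn_mul (contOn_mul continuousOn_const
    continuousOn_id) h1))

lemma resid_int (h : InvLaw l ν) (hr : 0 < Fintype.card r)
    (hln : l ≤ Fintype.card p + Fintype.card r)
    (hq : (Fintype.card p : ℝ) < l - alphaK K) (A : Matrix d (p ⊕ r) K) {s : ℝ} (hs : 0 < s) :
    ∫ P, frobSq (A - A * P * E1 (s ^ 2) P) ∂ν ≤ frobSq A.toCols₂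
      + (s ^ 2 + s) * (frobSq A.toCols₁ *
        (Fintype.card p * Fintype.card r / ((l : ℝ) - Fintype.card p - alphaK K)))
      + (1 + s) * (Fintype.card p / ((l : ℝ) - Fintype.card p - alphaK K) * frobSq A.toCols₂) := by
  have := h.prob
  have he : 0 < s ^ 2 := by positivity
  obtain ⟨m1, m2⟩ := moments h he hln hq
  have hsy := symm_int h he A.toCols₂
  have ha : Integrable (fun P => RCLike.re (Hb (s ^ 2) P).trace) ν :=
    h.integrable (contOn_re (contOn_trace (Hb_cont he)))
  have hB : Integrable (fun P => frobSq (A.toCols₂ * P.toBlocks₁₂ᴴ * Hb (s ^ 2) P)) ν :=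
    h.integrable (contOn_frobSq (contOn_mul (contOn_mul continuousOn_const
      (contOn_star cont12.continuousOn)) (Hb_cont he)))
  have h1 : ∫ P, frobSq (A - A * P * E1 (s ^ 2) P) ∂ν ≤ frobSq A.toCols₂
      + (1 + s⁻¹) * (frobSq A.toCols₁ * (s ^ 2 * ∫ P, RCLike.re (Hb (s ^ 2) P).trace ∂ν))
      + (1 + s) * ∫ P, frobSq (A.toCols₂ * P.toBlocks₁₂ᴴ * Hb (s ^ 2) P) ∂ν := by
    have i1 : Integrable (fun P => (1 + s⁻¹) * (frobSq A.toCols₁ *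
        (s ^ 2 * RCLike.re (Hb (s ^ 2) P).trace))) ν := ((ha.const_mul _).const_mul _).const_mul _
    have i2 : Integrable (fun P => (1 + s) *
        frobSq (A.toCols₂ * P.toBlocks₁₂ᴴ * Hb (s ^ 2) P)) ν := hB.const_mul _
    have i3 : Integrable (fun _ : Matrix (p ⊕ r) (p ⊕ r) K => frobSq A.toCols₂) ν :=
      integrable_const _
    have h2 := integral_mono_ae (h.integrable (E1_cont he A)) ((i3.add i1).add i2) (by
      filter_upwards [h.mem] with P hP
      exact resid_le A he hP hs)
    rw [integral_add' (i3.add i1) i2, integral_add' i3 i1] at h2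
    simp only [integral_const_mul] at h2
    simpa using h2
  refine h1.trans ?_
  have hc : 0 < (l : ℝ) - Fintype.card p - alphaK K := by linarith
  have hα : 0 ≤ alphaK K := by unfold alphaK; split_ifs <;> norm_num
  have hr' : (0 : ℝ) < Fintype.card r := by exact_mod_cast hr
  have f1 := frobSq_nonneg A.toCols₁
  have f2 := frobSq_nonneg A.toCols₂
  generalize ∫ P, frobSq (A.toCols₂ * P.toBlocks₁₂ᴴ * Hb (s ^ 2) P) ∂ν = b at *
  generalize ∫ P, RCLike.re (Hb (s ^ 2) P).trace ∂ν = a at *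
  generalize ∫ P, frobSq (Hb (s ^ 2) P * P.toBlocks₁₂) ∂ν = N at *
  have ha' : a ≤ Fintype.card p * Fintype.card r / ((l : ℝ) - Fintype.card p - alphaK K) := by
    rw [le_div_iff₀ hc]; linarith
  have hN : N ≤ Fintype.card p / ((l : ℝ) - Fintype.card p - alphaK K) * Fintype.card r := by
    rw [div_mul_eq_mul_div, le_div_iff₀ hc]
    have : (0 : ℝ) ≤ Fintype.card p := by positivity
    nlinarith
  have hb : b ≤ Fintype.card p / ((l : ℝ) - Fintype.card p - alphaK K) * frobSq A.toCols₂ := by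
    have := mul_le_mul_of_nonneg_left hN f2
    rw [← hsy] at this
    refine le_of_mul_le_mul_left ?_ hr'
    linarith
  have e1 : (1 + s⁻¹) * (frobSq A.toCols₁ * (s ^ 2 * a)) = (s ^ 2 + s) * (frobSq A.toCols₁ * a) := by
    field_simp
  rw [e1]
  gcongr

end resid

section reduction
variable {K : Type*} [RCLike K]

lemma frobSq_proj_le {a b : Type*} [Fintype a] [DecidableEq a] [Fintype b] {Q : Matrix a a K}
    (h1 : Qᴴ = Q) (h2 : Q * Q = Q) (C : Matrix a b K) : frobSq (Q * C) ≤ frobSq C := by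
  have h3 : frobSq ((1 - Q) * C) = frobSq C - frobSq (Q * C) := by
    rw [frobSq_eq', frobSq_eq', frobSq_eq', ← map_sub, ← Matrix.trace_sub]
    congr 2
    have e1 : Cᴴ * (Q * (Q * C)) = Cᴴ * (Q * C) := by
      rw [← Matrix.mul_assoc Q Q C, h2]
    simp only [Matrix.conjTranspose_mul, Matrix.conjTranspose_sub, Matrix.conjTranspose_one, h1,
      Matrix.sub_mul, Matrix.mul_sub, Matrix.one_mul, Matrix.mul_one, Matrix.mul_assoc, e1]
    abel
  have := frobSq_nonneg ((1 - Q) * C)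
  linarith

lemma best_proj {a b c : Type*} [Fintype a] [DecidableEq a] [Fintype b] [Fintype c]
    {F : Matrix a b K} {X : Matrix b a K} (h : IsMoorePenrose F X) (A : Matrix a c K)
    (Z : Matrix b c K) : frobSq (A - F * (X * A)) ≤ frobSq (A - F * Z) := by
  obtain ⟨h1, -, h3, -⟩ := h
  have e : A - F * (X * A) = (1 - F * X) * (A - F * Z) := by
    have : F * X * (F * Z) = F * Z := by rw [← Matrix.mul_assoc, h1]
    rw [Matrix.sub_mul, Matrix.mul_sub (F * X), this, Matrix.one_mul, Matrix.mul_assoc]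
    abel
  rw [e]
  have h5 : F * X * (F * X) = F * X := by rw [← Matrix.mul_assoc, h1]
  refine frobSq_proj_le ?_ ?_ _
  · simp [h3]
  · rw [Matrix.sub_mul, Matrix.mul_sub, Matrix.mul_sub (F * X), h5]; simp

lemma frobSq_mul_isom {a b c : Type*} [Fintype a] [Fintype b] [DecidableEq b] [Fintype c]
    (B : Matrix a b K) {V : Matrix b c K} (h : V * Vᴴ = 1) : frobSq (B * V) = frobSq B := by
  rw [frobSq_eq, frobSq_eq, Matrix.conjTranspose_mul, Matrix.mul_assoc, ← Matrix.mul_assoc V, h,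
    Matrix.one_mul]

lemma exists_V {d n q : ℕ} (hq : q ≤ n) (B : Matrix (Fin d) (Fin n) K) (hB : B.rank ≤ q) :
    ∃ V : Matrix (Fin n) (Fin q ⊕ Fin (n - q)) K, V * Vᴴ = 1 ∧ Vᴴ * V = 1 ∧
      (B * V).toCols₂ = 0 := by
  let f : EuclideanSpace K (Fin n) →ₗ[K] EuclideanSpace K (Fin d) := Matrix.toEuclideanLin B
  have hr : Module.finrank K f.range = B.rank := by
    rw [Matrix.rank_eq_finrank_range_toLin B (EuclideanSpace.basisFun (Fin d) K).toBasis
      (EuclideanSpace.basisFun (Fin n) K).toBasis, ← Matrix.toEuclideanLin_eq_toLin_orthonormal]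
  have hk : n - q ≤ Module.finrank K f.ker := by
    have := LinearMap.finrank_range_add_finrank_ker f
    rw [finrank_euclideanSpace_fin, hr] at this
    omega
  let w := stdOrthonormalBasis K f.ker
  let v : Fin q ⊕ Fin (n - q) → EuclideanSpace K (Fin n) :=
    Sum.elim (fun _ => 0) (fun j => (w (Fin.castLE hk j) : EuclideanSpace K (Fin n)))
  have hv : Orthonormal K ((Set.range Sum.inr : Set (Fin q ⊕ Fin (n - q))).domRestrict v) := by
    have h0 : Orthonormal K (fun j : Fin (n - q) =>
        (w (Fin.castLE hk j) : EuclideanSpace K (Fin n))) := by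
      have := w.orthonormal.comp_linearIsometry f.ker.subtypeₗᵢ
      exact this.comp _ (Fin.castLE_injective hk)
    rw [orthonormal_iff_ite] at h0 ⊢
    rintro ⟨_, i, rfl⟩ ⟨_, j, rfl⟩
    have := h0 i j
    simpa [v, Subtype.ext_iff] using this
  obtain ⟨b, hb⟩ := hv.exists_orthonormalBasis_extension_of_card_eq
    (by simp [hq])
  let V : Matrix (Fin n) (Fin q ⊕ Fin (n - q)) K := Matrix.of fun i j => b j i
  have h1 : Vᴴ * V = 1 := by
    ext j k
    have := orthonormal_iff_ite.1 b.orthonormal j k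
    rw [Matrix.one_apply, ← this, PiLp.inner_apply, Matrix.mul_apply]
    refine Finset.sum_congr rfl fun i _ => ?_
    simp [V, mul_comm]
  refine ⟨V, ?_, h1, ?_⟩
  · exact (Matrix.mul_eq_one_comm_of_card_eq _ _ _ (by simp [hq])).1 h1
  · ext i j
    have hbj : b (Sum.inr j) = (w (Fin.castLE hk j) : EuclideanSpace K (Fin n)) :=
      hb _ ⟨j, rfl⟩
    have hz : f (b (Sum.inr j)) = 0 := by rw [hbj]; exact (w (Fin.castLE hk j)).2
    have := congrArg (fun x : EuclideanSpace K (Fin d) => x i) hz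
    simp only [f, Matrix.toEuclideanLin_apply, PiLp.zero_apply] at this
    simpa [Matrix.toCols₂, Matrix.mul_apply, V, Matrix.mulVec, dotProduct] using this

lemma unit_of_rank {l : ℕ} {G : Matrix (Fin l) (Fin l) K} (h : G.rank = l) : IsUnit G.det := by
  rw [← Matrix.isUnit_iff_isUnit_det, ← Matrix.mulVec_surjective_iff_isUnit]
  have : G.mulVecLin.range = ⊤ := by
    apply Submodule.eq_top_of_finrank_eq
    rw [Module.finrank_fin_fun]
    exact h
  exact LinearMap.range_eq_top.1 this

variable {m : Type*} [Fintype m] [DecidableEq m] {l : ℕ}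

/-- Projection onto the column space. -/
def Phi (N : Matrix m (Fin l) K) : Matrix m m K := N * (Nᴴ * N)⁻¹ * Nᴴ

lemma Phi_mem {N : Matrix m (Fin l) K} (h : IsUnit (Nᴴ * N).det) : Phi N ∈ PS K m l := by
  refine ⟨?_, ?_, ?_⟩
  · simp [Phi, Matrix.conjTranspose_mul, Matrix.conjTranspose_nonsing_inv, Matrix.mul_assoc]
  · have : N * (Nᴴ * N)⁻¹ * Nᴴ * (N * (Nᴴ * N)⁻¹ * Nᴴ)
        = N * ((Nᴴ * N)⁻¹ * (Nᴴ * N)) * ((Nᴴ * N)⁻¹ * Nᴴ) := by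
      simp only [Matrix.mul_assoc]
    rw [Phi, this, Matrix.nonsing_inv_mul _ h, Matrix.mul_one, Matrix.mul_assoc]
  · rw [Phi, Matrix.mul_assoc, Matrix.trace_mul_comm, Matrix.mul_assoc,
      Matrix.nonsing_inv_mul _ h]
    simp

lemma Phi_mul {k : Type*} [Fintype k] [DecidableEq k] {U : Matrix k m K} (hU : Uᴴ * U = 1)
    (N : Matrix m (Fin l) K) : Phi (U * N) = U * Phi N * Uᴴ := by
  have : (U * N)ᴴ * (U * N) = Nᴴ * N := by
    rw [Matrix.conjTranspose_mul, Matrix.mul_assoc, ← Matrix.mul_assoc Uᴴ, hU, Matrix.one_mul]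
  rw [Phi, this, Phi, Matrix.conjTranspose_mul]
  simp only [Matrix.mul_assoc]

variable [MeasurableSpace K] [BorelSpace K]

lemma Phi_meas : Measurable (Phi : Matrix m (Fin l) K → Matrix m m K) := by
  have h : ∀ N : Matrix m (Fin l) K,
      Phi N = (Nᴴ * N).det⁻¹ • (N * (Nᴴ * N).adjugate * Nᴴ) := by
    intro N
    rw [Phi, Matrix.inv_def, Ring.inverse_eq_inv']
    simp
  have h1 : Measurable fun N : Matrix m (Fin l) K => (Nᴴ * N).det⁻¹ :=
    (Continuous.measurable (f := fun N : Matrix m (Fin l) K => (Nᴴ * N).det) (by fun_prop)).inv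
  have h2 : Measurable fun N : Matrix m (Fin l) K => N * (Nᴴ * N).adjugate * Nᴴ :=
    Continuous.measurable (by fun_prop)
  refine measurable_pi_iff.2 fun i => measurable_pi_iff.2 fun j => ?_
  simp only [h, Matrix.smul_apply, smul_eq_mul]
  exact h1.mul ((measurable_pi_iff.1 (measurable_pi_iff.1 h2 i)) j)

end reduction

section final
variable {K : Type*} [RCLike K] [MeasurableSpace K] [BorelSpace K]
  {Y : Type*} [MeasurableSpace Y] {μ : Measure Y} [IsProbabilityMeasure μ]
  {m : Type*} [Fintype m] [DecidableEq m] {n l : ℕ} {M : Y → Matrix (Fin n) (Fin l) K}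

lemma law (hMmeas : Measurable M) (hMfull : ∀ᵐ ω ∂μ, (M ω).rank = l)
    (hMrot : RotationInvariant μ M) {V : Matrix (Fin n) m K} (hV : V * Vᴴ = 1) (hV' : Vᴴ * V = 1) :
    InvLaw l (Measure.map (fun ω => Phi (Vᴴ * M ω)) μ) := by
  have hc : Measurable fun N : Matrix (Fin n) (Fin l) K => Phi (Vᴴ * N) :=
    Phi_meas.comp (Continuous.measurable (by fun_prop))
  have hm : Measurable fun ω => Phi (Vᴴ * M ω) := hc.comp hMmeas
  refine ⟨Measure.isProbabilityMeasure_map hm.aemeasurable, ?_, ?_⟩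
  · refine (ae_map_iff (p := fun P => P ∈ PS K m l) hm.aemeasurable
      (PS_compact l).isClosed.measurableSet).2 ?_
    filter_upwards [hMfull] with ω hω
    apply Phi_mem
    have : (Vᴴ * M ω)ᴴ * (Vᴴ * M ω) = (M ω)ᴴ * M ω := by
      rw [Matrix.conjTranspose_mul, Matrix.conjTranspose_conjTranspose, Matrix.mul_assoc,
        ← Matrix.mul_assoc V, hV, Matrix.one_mul]
    rw [this]
    apply unit_of_rank
    rw [Matrix.rank_conjTranspose_mul_self, hω]
  · intro U hU
    have hU1 : Uᴴ * U = 1 := Matrix.mem_unitaryGroup_iff'.1 hU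
    have hW : V * U * Vᴴ ∈ Matrix.unitaryGroup (Fin n) K := by
      rw [Matrix.mem_unitaryGroup_iff', Matrix.star_eq_conjTranspose]
      calc (V * U * Vᴴ)ᴴ * (V * U * Vᴴ) = V * (Uᴴ * ((Vᴴ * V) * U)) * Vᴴ := by
            simp only [Matrix.conjTranspose_mul, Matrix.conjTranspose_conjTranspose,
              Matrix.mul_assoc]
        _ = 1 := by rw [hV', Matrix.one_mul, hU1, Matrix.mul_one, hV]
    have hcU : Measurable fun P : Matrix m m K => U * P * Uᴴ :=
      Continuous.measurable (by fun_prop)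
    have hWm : Measurable fun ω => V * U * Vᴴ * M ω :=
      (Continuous.measurable (f := fun N : Matrix (Fin n) (Fin l) K => V * U * Vᴴ * N)
        (by fun_prop)).comp hMmeas
    have e2 := Measure.map_map (μ := μ) hc hMmeas
    have e3 := Measure.map_map (μ := μ) hc hWm
    rw [hMrot _ hW, e2] at e3
    rw [Measure.map_map hcU hm]
    change _ = Measure.map ((fun N : Matrix (Fin n) (Fin l) K => Phi (Vᴴ * N)) ∘ M) μ
    rw [e3]
    congr 1
    funext ω
    simp only [Function.comp]
    rw [← Phi_mul hU1]
    congr 1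
    simp only [← Matrix.mul_assoc]
    rw [hV', Matrix.one_mul]

lemma pointwise {d : ℕ} (A : Matrix (Fin d) (Fin n) K) {V : Matrix (Fin n) m K}
    (hV : V * Vᴴ = 1) (hV' : Vᴴ * V = 1) {X : Matrix (Fin l) (Fin d) K}
    {N : Matrix (Fin n) (Fin l) K} (hX : IsMoorePenrose (A * N) X) (E : Matrix m m K) :
    frobSq (A - (A * N) * (X * A)) ≤ frobSq (A * V - A * V * Phi (Vᴴ * N) * E) := by
  refine (best_proj hX A (((Vᴴ * N)ᴴ * (Vᴴ * N))⁻¹ * (Vᴴ * N)ᴴ * E * Vᴴ)).trans (le_of_eq ?_)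
  rw [← frobSq_mul_isom _ hV]
  congr 1
  rw [Matrix.sub_mul]
  congr 1
  have : A * V * Phi (Vᴴ * N) * E
      = A * (V * Vᴴ) * N * (((Vᴴ * N)ᴴ * (Vᴴ * N))⁻¹ * (Vᴴ * N)ᴴ * E) := by
    simp only [Phi, Matrix.mul_assoc]
  rw [this, hV, Matrix.mul_one]
  simp only [Matrix.mul_assoc, hV', Matrix.mul_one]

end final

end RSVD

/-- **Randomized SVD, existing analysis** (Theorem 3.1): for a full-rank
rotation-invariant random embedding `Ω` and any matrix `A`,
`E‖A − Π_{AΩ}A‖_F² ≤ (1 + q/(ℓ − q − α_K)) ‖A − [A]_q‖_F²` for all `q < ℓ − α_K`. -/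
theorem randomized_svd_hmt_bound
    {K : Type*} [RCLike K] [MeasurableSpace K] [BorelSpace K]
    {Y : Type*} [MeasurableSpace Y] (μ : Measure Y) [IsProbabilityMeasure μ]
    (pinv : (m n : ℕ) → Matrix (Fin m) (Fin n) K → Matrix (Fin n) (Fin m) K)
    (hpinv : ∀ (m n : ℕ) (A : Matrix (Fin m) (Fin n) K), IsMoorePenrose A (pinv m n A))
    (n ℓ d : ℕ) (hℓn : ℓ ≤ n)
    (M : Y → Matrix (Fin n) (Fin ℓ) K)
    (hMmeas : Measurable M)
    (hMfull : ∀ᵐ ω ∂μ, (M ω).rank = ℓ)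
    (hMrot : RotationInvariant μ M)
    (A : Matrix (Fin d) (Fin n) K) :
    ∀ (q : ℕ) (Aq : Matrix (Fin d) (Fin n) K),
      (q : ℝ) < (ℓ : ℝ) - alphaK K → IsBestRankApprox q A Aq →
      ∫ ω, frobSq (A - (A * M ω) * (pinv d ℓ (A * M ω) * A)) ∂μ ≤
        (1 + (q : ℝ) / ((ℓ : ℝ) - (q : ℝ) - alphaK K)) * frobSq (A - Aq) := by
  intro q Aq hq hAq
  have hα : 0 ≤ alphaK K := by unfold alphaK; split_ifs <;> norm_num
  have hqℓ : q < ℓ := by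
    have : (q : ℝ) < ℓ := by linarith
    exact_mod_cast this
  have hqn : q ≤ n := by omega
  obtain ⟨V, hV, hV', hVk⟩ := RSVD.exists_V hqn Aq hAq.1
  have hlaw := RSVD.law hMmeas hMfull hMrot hV hV'
  have hA2 : frobSq (A * V).toCols₂ ≤ frobSq (A - Aq) := by
    have e1 : (A * V).toCols₂ = ((A - Aq) * V).toCols₂ := by
      rw [Matrix.sub_mul]
      have : (A * V - Aq * V).toCols₂ = (A * V).toCols₂ - (Aq * V).toCols₂ := rfl
      rw [this, hVk, sub_zero]
    rw [e1, ← RSVD.frobSq_mul_isom (A - Aq) hV]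
    conv_rhs => rw [← Matrix.fromCols_toCols ((A - Aq) * V)]
    rw [RSVD.frobSq_fromCols]
    have := RSVD.frobSq_nonneg ((A - Aq) * V).toCols₁
    linarith
  have hmeas : Measurable fun ω => RSVD.Phi (Vᴴ * M ω) :=
    RSVD.Phi_meas.comp ((Continuous.measurable
      (f := fun N : Matrix (Fin n) (Fin ℓ) K => Vᴴ * N) (by fun_prop)).comp hMmeas)
  have hbound : ∀ s : ℝ, 0 < s →
      ∫ ω, frobSq (A - (A * M ω) * (pinv d ℓ (A * M ω) * A)) ∂μ ≤ frobSq (A * V).toCols₂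
        + (s ^ 2 + s) * (frobSq (A * V).toCols₁ *
          ((q : ℝ) * ((n - q : ℕ) : ℝ) / ((ℓ : ℝ) - q - alphaK K)))
        + (1 + s) * ((q : ℝ) / ((ℓ : ℝ) - q - alphaK K) * frobSq (A * V).toCols₂) := by
    intro s hs
    have hb := RSVD.resid_int hlaw (by simp; omega) (by simp; omega) (by simpa using hq) (A * V) hs
    simp only [Fintype.card_fin] at hb
    refine le_trans ?_ hb
    have hint := hlaw.integrable (RSVD.E1_cont (l := ℓ) (p := Fin q) (r := Fin (n - q))
      (show 0 < s ^ 2 by positivity) (A * V))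
    rw [integral_map hmeas.aemeasurable hint.aestronglyMeasurable]
    refine integral_mono_of_nonneg (Eventually.of_forall fun ω => RSVD.frobSq_nonneg _)
      ((integrable_map_measure hint.aestronglyMeasurable hmeas.aemeasurable).1 hint)
      (Eventually.of_forall fun ω => ?_)
    exact RSVD.pointwise A hV hV' (hpinv _ _ _) _
  have hlim : Tendsto (fun s : ℝ => frobSq (A * V).toCols₂
        + (s ^ 2 + s) * (frobSq (A * V).toCols₁ *
          ((q : ℝ) * ((n - q : ℕ) : ℝ) / ((ℓ : ℝ) - q - alphaK K)))
        + (1 + s) * ((q : ℝ) / ((ℓ : ℝ) - q - alphaK K) * frobSq (A * V).toCols₂)) (𝓝[>] 0)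
      (𝓝 (frobSq (A * V).toCols₂
        + ((0 : ℝ) ^ 2 + 0) * (frobSq (A * V).toCols₁ *
          ((q : ℝ) * ((n - q : ℕ) : ℝ) / ((ℓ : ℝ) - q - alphaK K)))
        + (1 + 0) * ((q : ℝ) / ((ℓ : ℝ) - q - alphaK K) * frobSq (A * V).toCols₂))) := by
    refine tendsto_nhdsWithin_of_tendsto_nhds (Continuous.tendsto ?_ 0)
    fun_prop
  have h1 := ge_of_tendsto hlim (by
    filter_upwards [self_mem_nhdsWithin] with s hs using hbound s hs)
  have hpos : 0 ≤ 1 + (q : ℝ) / ((ℓ : ℝ) - q - alphaK K) := by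
    have : 0 < (ℓ : ℝ) - q - alphaK K := by linarith
    positivity
  have h2 := mul_le_mul_of_nonneg_left hA2 hpos
  refine le_trans h1 (le_trans (le_of_eq ?_) h2)
  ring
end
end

section
/- Let Ω ∈ K^{n×ℓ} be a random embedding that has full column rank almost surely and satisfies UΩ ~ Ω for each unitary U ∈ K^{n×n}. Then for any matrix A ∈ K^{d×n} with r := rank(A) ≥ ℓ, E‖A − Π_{AΩ}A‖_F² ≤ min over natural numbers q with q < ℓ − α_K of ((r − ℓ)/(r − q)) · (1 + q/(ℓ − q − α_K)) · ‖A − [A]_q‖_F². -/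
open MeasureTheory ProbabilityTheory Matrix Filter
open scoped ENNReal Topology ComplexOrder

noncomputable section

section Proj
variable {K : Type*} [RCLike K] {ι κ : Type*} [Fintype ι] [Fintype κ] [DecidableEq ι] [DecidableEq κ]

def Pc (F : Matrix ι κ K) : Matrix ι ι K := 1 - F * (Fᴴ * F)⁻¹ * Fᴴ

def nsq (v : ι → K) : ℝ := ∑ k, ‖v k‖ ^ 2

omit [DecidableEq ι] in
theorem nsq_eq (v : ι → K) : ((nsq v : ℝ) : K) = star v ⬝ᵥ v := by
  simp [nsq, dotProduct, RCLike.conj_mul]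

theorem Pc_herm (F : Matrix ι κ K) : (Pc F)ᴴ = Pc F := by
  simp [Pc, conjTranspose_sub, conjTranspose_mul, conjTranspose_nonsing_inv, Matrix.mul_assoc]

theorem Pc_mul (F : Matrix ι κ K) (h : IsUnit (Fᴴ * F).det) : Pc F * F = 0 := by
  simp only [Pc, Matrix.sub_mul, Matrix.one_mul, Matrix.mul_assoc]
  rw [Matrix.nonsing_inv_mul _ h]; simp

theorem Pc_idem (F : Matrix ι κ K) (h : IsUnit (Fᴴ * F).det) : Pc F * Pc F = Pc F := by
  conv_lhs => rhs; unfold Pc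
  rw [Matrix.mul_sub, Matrix.mul_one, ← Matrix.mul_assoc, ← Matrix.mul_assoc, Pc_mul F h]; simp

theorem Pc_trace (F : Matrix ι κ K) (h : IsUnit (Fᴴ * F).det) :
    (Pc F).trace = (Fintype.card ι : K) - Fintype.card κ := by
  rw [Pc, Matrix.trace_sub, Matrix.trace_one, Matrix.mul_assoc, Matrix.trace_mul_comm,
    Matrix.mul_assoc, Matrix.nonsing_inv_mul _ h, Matrix.trace_one]

structure IsProj (P : Matrix ι ι K) : Prop where
  herm : Pᴴ = P
  idem : P * P = P

theorem Pc_isProj (F : Matrix ι κ K) (h : IsUnit (Fᴴ * F).det) : IsProj (Pc F) :=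
  ⟨Pc_herm F, Pc_idem F h⟩

omit [DecidableEq ι] in
theorem IsProj.nsq_mulVec {P : Matrix ι ι K} (hP : IsProj P) (w : ι → K) :
    ((nsq (P *ᵥ w) : ℝ) : K) = star w ⬝ᵥ (P *ᵥ w) := by
  rw [nsq_eq, star_mulVec, hP.herm, ← dotProduct_mulVec, mulVec_mulVec, hP.idem]

theorem IsProj.compl {P : Matrix ι ι K} (hP : IsProj P) : IsProj (1 - P) := by
  refine ⟨by simp [conjTranspose_sub, hP.herm], ?_⟩
  simp [Matrix.mul_sub, Matrix.sub_mul, hP.idem]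

omit [DecidableEq ι] in
theorem nsq_nonneg (v : ι → K) : 0 ≤ nsq v := Finset.sum_nonneg fun _ _ => by positivity

omit [DecidableEq ι] in
theorem IsProj.nsq_le {P : Matrix ι ι K} (hP : IsProj P) (w : ι → K) : nsq (P *ᵥ w) ≤ nsq w := by
  classical
  have h1 := hP.compl.nsq_mulVec w
  have h2 := hP.nsq_mulVec w
  have h3 := nsq_eq w
  rw [Matrix.sub_mulVec, Matrix.one_mulVec, dotProduct_sub, ← h2, ← h3, ← RCLike.ofReal_sub] at h1
  have := RCLike.ofReal_injective (K := K) h1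
  have := nsq_nonneg (w - P *ᵥ w)
  linarith

omit [DecidableEq ι] in
theorem IsProj.sum_row {P : Matrix ι ι K} (hP : IsProj P) (i : ι) :
    ∑ j, ‖P i j‖ ^ 2 = RCLike.re (P i i) := by
  have h : (P * P) i i = P i i := by rw [hP.idem]
  rw [Matrix.mul_apply] at h
  rw [← h, map_sum]
  refine Finset.sum_congr rfl fun j _ => ?_
  have : P j i = star (P i j) := by
    conv_lhs => rw [← hP.herm]
    rfl
  rw [this, RCLike.star_def, RCLike.mul_conj]
  norm_cast

omit [DecidableEq ι] [Fintype ι] in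
theorem herm_apply {P : Matrix ι ι K} (hP : Pᴴ = P) (i j : ι) :
    P j i = star (P i j) := by
  conv_lhs => rw [← hP]
  rfl

omit [DecidableEq ι] [Fintype ι] in
theorem herm_diag {P : Matrix ι ι K} (hP : Pᴴ = P) (i : ι) :
    ((RCLike.re (P i i) : ℝ) : K) = P i i := by
  have := herm_apply hP i i
  rw [RCLike.star_def] at this
  exact RCLike.conj_eq_iff_re.1 this.symm

omit [DecidableEq ι] in
theorem IsProj.norm_le_one {P : Matrix ι ι K} (hP : IsProj P) (i j : ι) : ‖P i j‖ ≤ 1 := by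
  have h := hP.sum_row i
  have h1 : ∀ j, ‖P i j‖ ^ 2 ≤ RCLike.re (P i i) := fun j => by
    rw [← h]
    exact Finset.single_le_sum (f := fun j => ‖P i j‖ ^ 2) (fun _ _ => by positivity) (Finset.mem_univ j)
  have h2 : RCLike.re (P i i) ≤ ‖P i i‖ := RCLike.re_le_norm _
  have h3 := h1 i
  have h4 : ‖P i i‖ ≤ 1 := by nlinarith [norm_nonneg (P i i)]
  have h5 := h1 j
  nlinarith [norm_nonneg (P i j)]

theorem isUnit_gram {F : Matrix ι κ K} (h : ∀ x, F *ᵥ x = 0 → x = 0) : IsUnit (Fᴴ * F).det := by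
  rw [isUnit_iff_ne_zero]
  intro h0
  obtain ⟨v, hv, hv2⟩ := Matrix.exists_mulVec_eq_zero_iff.2 h0
  exact hv (h v (Matrix.conjTranspose_mul_self_mulVec_eq_zero F v |>.1 hv2))

theorem gram_inj {F : Matrix ι κ K} (h : IsUnit (Fᴴ * F).det) : ∀ x, F *ᵥ x = 0 → x = 0 := by
  intro x hx
  by_contra hne
  rw [isUnit_iff_ne_zero] at h
  refine h (Matrix.exists_mulVec_eq_zero_iff.1 ⟨x, hne, ?_⟩)
  rw [← mulVec_mulVec, hx, mulVec_zero]

variable [MeasurableSpace K] [BorelSpace K]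

omit [DecidableEq ι] [DecidableEq κ] in
theorem matrixBorel : BorelSpace (Matrix ι κ K) := inferInstanceAs (BorelSpace (ι → κ → K))

theorem measurable_Pc : Measurable (fun F : Matrix ι κ K => Pc F) := by
  haveI : BorelSpace (Matrix ι κ K) := matrixBorel
  refine measurable_pi_iff.2 fun i => measurable_pi_iff.2 fun j => ?_
  have : (fun F : Matrix ι κ K => Pc F i j) = fun F => (1 : Matrix ι ι K) i j -
      (Fᴴ * F).det⁻¹ * (F * (Fᴴ * F).adjugate * Fᴴ) i j := by
    ext F
    simp [Pc, Matrix.inv_def, Matrix.mul_smul, Matrix.smul_mul]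
  rw [this]
  refine measurable_const.sub (Measurable.mul (Measurable.inv ?_) ?_)
  · apply Continuous.measurable; fun_prop
  · apply Continuous.measurable
    refine Continuous.matrix_elem ?_ i j
    fun_prop
end Proj

section Rot
variable {K : Type*} [RCLike K] {ι κ : Type*} [Fintype ι] [Fintype κ] [DecidableEq ι] [DecidableEq κ]

/-- diagonal real matrix -/
def dg (K : Type*) [RCLike K] {ι : Type*} [DecidableEq ι] (e : ι → ℝ) : Matrix ι ι K :=
  diagonal fun i => (e i : K)

theorem Pc_variational (e : ι → ℝ) (he : ∀ i, 0 < e i) (Om : Matrix ι κ K)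
    (hO : ∀ x, Om *ᵥ x = 0 → x = 0) (U : Matrix ι ι K) (hU : U ∈ unitaryGroup ι K) (y : ι → K) :
    nsq (Pc (dg K e * (U * Om)) *ᵥ (dg K e *ᵥ y)) ≤
      nsq (dg K e *ᵥ (U *ᵥ (dg K (fun i => (e i)⁻¹) *ᵥ
        (Pc (dg K e * Om) *ᵥ (dg K e *ᵥ (Uᴴ *ᵥ y)))))) := by
  have hEinv : dg K (fun i => (e i)⁻¹) * dg K e = 1 := by
    rw [dg, dg, diagonal_mul_diagonal, ← diagonal_one]
    congr 1; ext i
    have := (he i).ne'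
    simp only [← RCLike.ofReal_mul]
    rw [inv_mul_cancel₀ this]; simp
  have hUU : U * Uᴴ = 1 := by
    have := (Matrix.mem_unitaryGroup_iff (A := U)).1 hU
    simpa [star_eq_conjTranspose] using this
  have hUU' : Uᴴ * U = 1 := by
    have := (Matrix.mem_unitaryGroup_iff' (A := U)).1 hU
    simpa [star_eq_conjTranspose] using this
  have inj : ∀ x, (dg K e * (U * Om)) *ᵥ x = 0 → x = 0 := by
    intro x hx
    apply hO
    have : (Uᴴ * (dg K (fun i => (e i)⁻¹))) *ᵥ ((dg K e * (U * Om)) *ᵥ x) = 0 := by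
      rw [hx, mulVec_zero]
    rw [mulVec_mulVec] at this
    have h2 : Uᴴ * dg K (fun i => (e i)⁻¹) * (dg K e * (U * Om)) = Om := by
      calc _ = Uᴴ * (dg K (fun i => (e i)⁻¹) * dg K e) * U * Om := by simp only [Matrix.mul_assoc]
        _ = _ := by rw [hEinv, Matrix.mul_one, hUU', Matrix.one_mul]
    rwa [h2] at this
  have hu := isUnit_gram inj
  set F := dg K e * Om with hF
  set w := dg K e *ᵥ (Uᴴ *ᵥ y) with hw
  set x := ((Fᴴ * F)⁻¹ * Fᴴ) *ᵥ w with hx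
  have h1 : Pc F *ᵥ w = w - F *ᵥ x := by
    clear_value w
    rw [hx, mulVec_mulVec, Pc, sub_mulVec, one_mulVec, Matrix.mul_assoc]
  have h2 : dg K e *ᵥ (U *ᵥ (dg K (fun i => (e i)⁻¹) *ᵥ (Pc F *ᵥ w))) =
      dg K e *ᵥ y - (dg K e * (U * Om)) *ᵥ x := by
    rw [h1, mulVec_sub, mulVec_sub, mulVec_sub, hw, hF]
    simp only [mulVec_mulVec]
    congr 2
    · calc _ = dg K e * U * (dg K (fun i => (e i)⁻¹) * dg K e) * Uᴴ := by
            simp only [Matrix.mul_assoc]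
        _ = _ := by rw [hEinv, Matrix.mul_one, Matrix.mul_assoc, hUU, Matrix.mul_one]
    · calc _ = dg K e * U * (dg K (fun i => (e i)⁻¹) * dg K e) * Om := by
            simp only [Matrix.mul_assoc]
        _ = _ := by rw [hEinv, Matrix.mul_one, Matrix.mul_assoc]
  rw [h2]
  have h3 : Pc (dg K e * (U * Om)) *ᵥ (dg K e *ᵥ y) = Pc (dg K e * (U * Om)) *ᵥ
      (dg K e *ᵥ y - (dg K e * (U * Om)) *ᵥ x) := by
    rw [mulVec_sub, mulVec_mulVec x, Pc_mul _ hu]; simp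
  rw [h3]
  exact (Pc_isProj _ hu).nsq_le _

def Rot (K : Type*) [RCLike K] {ι : Type*} [DecidableEq ι] (i j : ι) (c s : ℝ) : Matrix ι ι K :=
  1 + ((c : K) - 1) • (single i i 1 + single j j 1) + (s : K) • (single j i 1 - single i j 1)

theorem Rot_star (i j : ι) (c s : ℝ) : (Rot K i j c s)ᴴ = Rot K i j c (-s) := by
  simp only [Rot, conjTranspose_add, conjTranspose_smul, conjTranspose_sub, conjTranspose_single,
    conjTranspose_one, star_one]
  simp [smul_sub]
  abel

theorem Rot_mul {i j : ι} (hij : i ≠ j) (c s : ℝ) (h : c ^ 2 + s ^ 2 = 1) :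
    Rot K i j c (-s) * Rot K i j c s = 1 := by
  have hK : (c : K) ^ 2 + (s : K) ^ 2 = 1 := by exact_mod_cast congrArg (fun x : ℝ => (x : K)) h
  set Q : Matrix ι ι K := single i i 1 + single j j 1 with hQ
  set X : Matrix ι ι K := single j i 1 - single i j 1 with hX
  have hQQ : Q * Q = Q := by simp [hQ, Matrix.mul_add, Matrix.add_mul, hij, hij.symm]
  have hQX : Q * X = X := by
    simp [hQ, hX, Matrix.mul_sub, Matrix.add_mul, hij, hij.symm]
  have hXQ : X * Q = X := by
    simp [hQ, hX, Matrix.mul_add, Matrix.sub_mul, hij, hij.symm]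
    abel
  have hXX : X * X = -Q := by
    simp [hQ, hX, Matrix.mul_sub, Matrix.sub_mul, hij, hij.symm]
    abel
  have : Rot K i j c (-s) * Rot K i j c s = 1 + (2 * ((c : K) - 1) + ((c : K) - 1) ^ 2 + (s : K) ^ 2) • Q := by
    simp only [Rot, ← hQ, ← hX, Matrix.mul_add, Matrix.add_mul, smul_mul_smul_comm, hQQ, hQX, hXQ, hXX,
      Matrix.mul_one, Matrix.one_mul]
    push_cast
    module
  rw [this, show (2 * ((c : K) - 1) + ((c : K) - 1) ^ 2 + (s : K) ^ 2) = 0 by linear_combination hK]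
  simp

theorem Rot_mem {i j : ι} (hij : i ≠ j) (c s : ℝ) (h : c ^ 2 + s ^ 2 = 1) :
    Rot K i j c s ∈ unitaryGroup ι K := by
  rw [Matrix.mem_unitaryGroup_iff', star_eq_conjTranspose, Rot_star, Rot_mul hij c s h]

theorem Rot_mulVec {i j : ι} (hij : i ≠ j) (c s : ℝ) (v : ι → K) :
    Rot K i j c s *ᵥ v = v + Pi.single i (((c : K) - 1) * v i - s * v j)
      + Pi.single j (((c : K) - 1) * v j + s * v i) := by
  simp only [Rot, add_mulVec, sub_mulVec, smul_mulVec, single_mulVec, one_mulVec]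
  ext k
  by_cases h1 : k = i
  · subst h1
    simp [Function.update_apply, Pi.single_apply, hij, RCLike.real_smul_eq_coe_mul]
    ring
  by_cases h2 : k = j
  · subst h2
    simp [Function.update_apply, Pi.single_apply, h1, RCLike.real_smul_eq_coe_mul]
    ring
  simp [Function.update_apply, Pi.single_apply, h1, h2]

theorem dg_mulVec (e : ι → ℝ) (v : ι → K) (i : ι) : (dg K e *ᵥ v) i = e i * v i := by
  simp [dg, mulVec_diagonal]

theorem nsq_rot (e : ι → ℝ) (he : ∀ i, 0 < e i) {i j : ι} (hij : i ≠ j) (c s : ℝ)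
    (h : c ^ 2 + s ^ 2 = 1) (g : ι → K) :
    nsq (dg K e *ᵥ (Rot K i j c s *ᵥ (dg K (fun i => (e i)⁻¹) *ᵥ g))) =
      nsq g + s ^ 2 * ((e j ^ 2 / e i ^ 2 - 1) * ‖g i‖ ^ 2 + (e i ^ 2 / e j ^ 2 - 1) * ‖g j‖ ^ 2)
       + c * s * (2 * (e j / e i - e i / e j)) *
        (RCLike.re (g i) * RCLike.re (g j) + RCLike.im (g i) * RCLike.im (g j)) := by
  have hi := (he i).ne'
  have hj := (he j).ne'
  set v := dg K e *ᵥ (Rot K i j c s *ᵥ (dg K (fun i => (e i)⁻¹) *ᵥ g)) with hv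
  have hvk : ∀ k, k ≠ i ∧ k ≠ j → ‖v k‖ ^ 2 - ‖g k‖ ^ 2 = 0 := by
    rintro k ⟨h1, h2⟩
    have hk : (e k : K) ≠ 0 := by exact_mod_cast (he k).ne'
    have : v k = g k := by
      rw [hv, Rot_mulVec hij]
      simp [dg_mulVec, h1, h2, hk]
    rw [this, sub_self]
  have hvi : v i = ((c : ℝ) : K) * g i - ((s * (e i / e j) : ℝ) : K) * g j := by
    have hk : (e i : K) ≠ 0 := by exact_mod_cast hi
    rw [hv, Rot_mulVec hij]
    simp [dg_mulVec, hij]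
    field_simp
    ring
  have hvj : v j = ((c : ℝ) : K) * g j + ((s * (e j / e i) : ℝ) : K) * g i := by
    have hk : (e j : K) ≠ 0 := by exact_mod_cast hj
    rw [hv, Rot_mulVec hij]
    simp [dg_mulVec, hij.symm]
    field_simp
    ring
  have hsum : nsq v - nsq g = (‖v i‖ ^ 2 - ‖g i‖ ^ 2) + (‖v j‖ ^ 2 - ‖g j‖ ^ 2) := by
    rw [nsq, nsq, ← Finset.sum_sub_distrib]
    exact Finset.sum_eq_add i j hij (fun k _ hk => hvk k hk) (by simp) (by simp)
  have e1 : nsq v = nsq g + ((‖v i‖ ^ 2 - ‖g i‖ ^ 2) + (‖v j‖ ^ 2 - ‖g j‖ ^ 2)) := by linarith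
  rw [e1, hvi, hvj]
  simp only [RCLike.norm_sq_eq_def, map_add, map_sub, RCLike.re_ofReal_mul, RCLike.im_ofReal_mul]
  generalize RCLike.re (g i) = a
  generalize RCLike.re (g j) = b
  generalize RCLike.im (g i) = a'
  generalize RCLike.im (g j) = b'
  have hc : c ^ 2 = 1 - s ^ 2 := by linarith
  rw [show e j / e i - e i / e j = (e j ^ 2 - e i ^ 2) / (e i * e j) by field_simp]
  field_simp
  ring_nf
  simp only [hc]
  ring

end Rot

section Ident
variable {K : Type*} [RCLike K] {ι κ : Type*} [Fintype ι] [Fintype κ] [DecidableEq ι] [DecidableEq κ]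

def cf (c s : ℝ) : Fin 9 → ℝ := ![(c+s)^2, (c-s)^2, c^2-s^2, s^2*(c+s)^2, s^2*(c-s)^2,
  s^2*((c+s)*(c-s)), c*s*(c+s)^2, c*s*(c-s)^2, c*s*((c+s)*(c-s))]

def psiR (ei ej a b x y : ℝ) : Fin 9 → ℝ :=
  ![ei^2*a, ej^2*b, 2*ei*ej*x,
    (ej^2/ei^2-1)*ei^2*a^2 + (ei^2/ej^2-1)*ei^2*(x^2+y^2),
    (ej^2/ei^2-1)*ej^2*(x^2+y^2) + (ei^2/ej^2-1)*ej^2*b^2,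
    2*(ej^2/ei^2-1)*ei*ej*a*x + 2*(ei^2/ej^2-1)*ei*ej*x*b,
    2*(ej/ei-ei/ej)*ei^2*(a*x), 2*(ej/ei-ei/ej)*ej^2*(b*x),
    2*(ej/ei-ei/ej)*ei*ej*(a*b+(x^2-y^2))]

theorem psi_ptw (e : ι → ℝ) (he : ∀ i, 0 < e i) {i j : ι} (hij : i ≠ j) (c s : ℝ)
    (h : c ^ 2 + s ^ 2 = 1) (P : Matrix ι ι K) (hP : IsProj P) :
    nsq (dg K e *ᵥ (Rot K i j c s *ᵥ (dg K (fun i => (e i)⁻¹) *ᵥ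
        (P *ᵥ (dg K e *ᵥ ((Rot K i j c s)ᴴ *ᵥ (Pi.single i 1 + Pi.single j 1))))))) =
    ∑ k, cf c s k * psiR (e i) (e j) (RCLike.re (P i i)) (RCLike.re (P j j))
      (RCLike.re (P i j)) (RCLike.im (P i j)) k := by
  have hw : dg K e *ᵥ ((Rot K i j c s)ᴴ *ᵥ (Pi.single i 1 + Pi.single j 1)) =
      Pi.single i ((((c + s) * e i : ℝ)) : K) + Pi.single j ((((c - s) * e j : ℝ)) : K) := by
    rw [Rot_star, Rot_mulVec hij]
    ext k
    rw [dg_mulVec]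
    by_cases h1 : k = i
    · subst h1; simp [hij]; ring
    by_cases h2 : k = j
    · subst h2; simp [h1]; ring
    simp [h1, h2]
  rw [hw, nsq_rot e he hij c s h]
  have hg : ∀ k, (P *ᵥ (Pi.single i ((((c + s) * e i : ℝ)) : K) +
      Pi.single j ((((c - s) * e j : ℝ)) : K))) k =
      (((c + s) * e i : ℝ) : K) * P k i + (((c - s) * e j : ℝ) : K) * P k j := by
    intro k
    rw [mulVec_add, Pi.add_apply, mulVec_single, mulVec_single]
    simp [mul_comm]
  have hn : nsq (P *ᵥ (Pi.single i ((((c + s) * e i : ℝ)) : K) +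
      Pi.single j ((((c - s) * e j : ℝ)) : K))) = (c+s)^2 * (e i)^2 * RCLike.re (P i i) +
        (c-s)^2 * (e j)^2 * RCLike.re (P j j) + (c^2-s^2) * (2 * e i * e j * RCLike.re (P i j)) := by
    have h1 := hP.nsq_mulVec (Pi.single i ((((c + s) * e i : ℝ)) : K) +
      Pi.single j ((((c - s) * e j : ℝ)) : K))
    have h2 := congrArg RCLike.re h1
    rw [RCLike.ofReal_re] at h2
    rw [h2, star_add, add_dotProduct, Pi.star_single, Pi.star_single, single_dotProduct,
      single_dotProduct, hg, hg]
    rw [herm_apply hP.herm i j, RCLike.star_def,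
      RCLike.conj_ofReal, RCLike.conj_ofReal]
    simp only [map_add, RCLike.re_ofReal_mul, RCLike.conj_re]
    ring
  have hii : RCLike.im (P i i) = 0 := by rw [← herm_diag hP.herm i]; simp
  have hjj : RCLike.im (P j j) = 0 := by rw [← herm_diag hP.herm j]; simp
  rw [hn, hg, hg, herm_apply hP.herm i j]
  simp only [RCLike.norm_sq_eq_def, map_add, RCLike.re_ofReal_mul, RCLike.im_ofReal_mul,
    RCLike.star_def, RCLike.conj_re, RCLike.conj_im, hii, hjj, Fin.sum_univ_succ, cf, psiR]
  simp
  ring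

theorem psi_min (M : Fin 9 → ℝ)
    (h : ∀ θ : ℝ, ∑ k, cf 1 0 k * M k ≤ ∑ k, cf (Real.cos θ) (Real.sin θ) k * M k) :
    2 * M 0 - 2 * M 1 + M 6 + M 7 + M 8 = 0 := by
  have hc := Real.hasDerivAt_cos 0
  have hs := Real.hasDerivAt_sin 0
  rw [Real.sin_zero, neg_zero] at hc
  rw [Real.cos_zero] at hs
  set f : ℝ → ℝ := fun θ => ∑ k, cf (Real.cos θ) (Real.sin θ) k * M k with hf
  have hmin : IsLocalMin f 0 := by
    refine Filter.Eventually.of_forall fun θ => ?_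
    simpa [hf] using h θ
  have hcf : ∀ k, HasDerivAt (fun θ => cf (Real.cos θ) (Real.sin θ) k)
      ((![2, -2, 0, 0, 0, 0, 1, 1, 1] : Fin 9 → ℝ) k) 0 := by
    intro k
    have p := hc.add hs
    have m := hc.sub hs
    fin_cases k
    · exact (p.pow 2).congr_deriv (by simp)
    · exact (m.pow 2).congr_deriv (by simp)
    · exact ((hc.pow 2).sub (hs.pow 2)).congr_deriv (by simp)
    · exact ((hs.pow 2).mul (p.pow 2)).congr_deriv (by simp)
    · exact ((hs.pow 2).mul (m.pow 2)).congr_deriv (by simp)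
    · exact ((hs.pow 2).mul (p.mul m)).congr_deriv (by simp)
    · exact ((hc.mul hs).mul (p.pow 2)).congr_deriv (by simp)
    · exact ((hc.mul hs).mul (m.pow 2)).congr_deriv (by simp)
    · exact ((hc.mul hs).mul (p.mul m)).congr_deriv (by simp)
  have hd : HasDerivAt f (∑ k, (![2, -2, 0, 0, 0, 0, 1, 1, 1] : Fin 9 → ℝ) k * M k) 0 := by
    rw [hf]
    exact HasDerivAt.fun_sum fun k _ => (hcf k).mul_const (M k)
  have := hmin.hasDerivAt_eq_zero hd
  simp [Fin.sum_univ_succ] at this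
  have e6 : M 6 = M (Fin.succ (Fin.succ (Fin.succ (Fin.succ (Fin.succ (Fin.succ 0)))))) := rfl
  linarith!

end Ident

section Expect
variable {K : Type*} [RCLike K] [MeasurableSpace K] [BorelSpace K]
  {ι κ : Type*} [Fintype ι] [Fintype κ] [DecidableEq ι] [DecidableEq κ]
  {Y : Type*} [MeasurableSpace Y]

structure GoodEmb (μ : Measure Y) (Om : Y → Matrix ι κ K) : Prop where
  meas : Measurable Om
  rot : ∀ U ∈ unitaryGroup ι K, Measure.map (fun ω => U * Om ω) μ = Measure.map Om μ
  inj : ∀ᵐ ω ∂μ, ∀ x, Om ω *ᵥ x = 0 → x = 0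

theorem dg_inj (e : ι → ℝ) (he : ∀ i, 0 < e i) (Om : Matrix ι κ K)
    (hO : ∀ x, Om *ᵥ x = 0 → x = 0) : ∀ x, (dg K e * Om) *ᵥ x = 0 → x = 0 := by
  intro x hx
  apply hO
  rw [← mulVec_mulVec] at hx
  ext i
  have := congrFun hx i
  rw [dg_mulVec] at this
  have hk : (e i : K) ≠ 0 := by exact_mod_cast (he i).ne'
  simpa [hk] using this

theorem measurable_PE (e : ι → ℝ) :
    Measurable (fun O : Matrix ι κ K => Pc (dg K e * O)) := by
  have : BorelSpace (Matrix ι κ K) := matrixBorel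
  refine measurable_Pc.comp ?_
  apply Continuous.measurable; fun_prop

variable {μ : Measure Y} [IsProbabilityMeasure μ] {Om : Y → Matrix ι κ K}

theorem GoodEmb.isProj (h : GoodEmb μ Om) (e : ι → ℝ) (he : ∀ i, 0 < e i) :
    ∀ᵐ ω ∂μ, IsProj (Pc (dg K e * Om ω)) := by
  filter_upwards [h.inj] with ω hω
  exact Pc_isProj _ (isUnit_gram (dg_inj e he _ hω))

theorem GoodEmb.integrable (h : GoodEmb μ Om) (e : ι → ℝ) (he : ∀ i, 0 < e i)
    (f : Matrix ι ι K → ℝ) (hf : Continuous f) :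
    Integrable (fun ω => f (Pc (dg K e * Om ω))) μ := by
  have : BorelSpace (Matrix ι ι K) := matrixBorel
  have hc : IsCompact (Set.univ.pi fun _ : ι => Set.univ.pi fun _ : ι => Metric.closedBall (0 : K) 1) :=
    isCompact_univ_pi fun _ => isCompact_univ_pi fun _ => isCompact_closedBall 0 1
  obtain ⟨C, hC⟩ := hc.exists_bound_of_continuousOn (f := f) hf.continuousOn
  refine Integrable.of_bound (C := C) ?_ ?_
  · exact (hf.measurable.comp ((measurable_PE e).comp h.meas)).aestronglyMeasurable
  · filter_upwards [h.isProj e he] with ω hω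
    refine hC _ fun i _ j _ => ?_
    simpa using hω.norm_le_one i j

theorem GoodEmb.left (h : GoodEmb μ Om) (U : Matrix ι ι K) (hU : U ∈ unitaryGroup ι K) :
    GoodEmb μ (fun ω => U * Om ω) := by
  have : BorelSpace (Matrix ι κ K) := matrixBorel
  have hm : ∀ V : Matrix ι ι K, Measurable (fun O : Matrix ι κ K => V * O) := fun V => by
    apply Continuous.measurable; fun_prop
  refine ⟨(hm U).comp h.meas, fun V hV => ?_, ?_⟩
  · rw [h.rot U hU, ← h.rot (V * U) (mul_mem hV hU)]
    simp only [Matrix.mul_assoc]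
  · filter_upwards [h.inj] with ω hω x hx
    apply hω
    have hUU' : Uᴴ * U = 1 := by
      have := (Matrix.mem_unitaryGroup_iff' (A := U)).1 hU
      simpa [star_eq_conjTranspose] using this
    have : (Uᴴ * (U * Om ω)) *ᵥ x = 0 := by rw [← mulVec_mulVec, hx, mulVec_zero]
    rwa [← Matrix.mul_assoc, hUU', Matrix.one_mul] at this

theorem GoodEmb.integral_left (h : GoodEmb μ Om) (U : Matrix ι ι K) (hU : U ∈ unitaryGroup ι K)
    (f : Matrix ι κ K → ℝ) (hf : Measurable f) :
    ∫ ω, f (U * Om ω) ∂μ = ∫ ω, f (Om ω) ∂μ := by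
  have h1 := integral_map (μ := μ) (h.left U hU).meas.aemeasurable (f := f) hf.aestronglyMeasurable
  have h2 := integral_map (μ := μ) h.meas.aemeasurable (f := f) hf.aestronglyMeasurable
  rw [← h1, ← h2, h.rot U hU]

theorem GoodEmb.ident1 (h : GoodEmb μ Om) (e : ι → ℝ) (he : ∀ i, 0 < e i) {i j : ι} (hij : i ≠ j) :
    e i ^ 2 * (∫ ω, RCLike.re (Pc (dg K e * Om ω) i i) ∂μ) -
    e j ^ 2 * (∫ ω, RCLike.re (Pc (dg K e * Om ω) j j) ∂μ) +
    (e j / e i - e i / e j) * (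
     e i ^ 2 * (∫ ω, RCLike.re (Pc (dg K e * Om ω) i i) * RCLike.re (Pc (dg K e * Om ω) i j) ∂μ) +
     e j ^ 2 * (∫ ω, RCLike.re (Pc (dg K e * Om ω) j j) * RCLike.re (Pc (dg K e * Om ω) i j) ∂μ)) +
    (e j ^ 2 - e i ^ 2) * (
      (∫ ω, RCLike.re (Pc (dg K e * Om ω) i i) * RCLike.re (Pc (dg K e * Om ω) j j) ∂μ) +
      ∫ ω, RCLike.re (Pc (dg K e * Om ω) i j * Pc (dg K e * Om ω) i j) ∂μ) = 0 := by
  have hi := (he i).ne'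
  have hj := (he j).ne'
  set R : Y → Fin 9 → ℝ := fun ω => psiR (e i) (e j) (RCLike.re (Pc (dg K e * Om ω) i i))
    (RCLike.re (Pc (dg K e * Om ω) j j)) (RCLike.re (Pc (dg K e * Om ω) i j))
    (RCLike.im (Pc (dg K e * Om ω) i j)) with hR
  have ce : ∀ k l : ι, Continuous fun P : Matrix ι ι K => P k l := fun k l => continuous_id.matrix_elem k l
  have cr : ∀ k l : ι, Continuous fun P : Matrix ι ι K => RCLike.re (P k l) :=
    fun k l => RCLike.continuous_re.comp (ce k l)
  have ci : ∀ k l : ι, Continuous fun P : Matrix ι ι K => RCLike.im (P k l) :=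
    fun k l => RCLike.continuous_im.comp (ce k l)
  have hRi : ∀ k, Integrable (fun ω => R ω k) μ := by
    intro k
    refine h.integrable e he (fun P => psiR (e i) (e j) (RCLike.re (P i i))
      (RCLike.re (P j j)) (RCLike.re (P i j)) (RCLike.im (P i j)) k) ?_
    have c1 := cr i i
    have c2 := cr j j
    have c3 := cr i j
    have c4 := ci i j
    fin_cases k <;> simp [psiR] <;> fun_prop
  have hsum : ∀ c s : ℝ, ∫ ω, ∑ k, cf c s k * R ω k ∂μ = ∑ k, cf c s k * ∫ ω, R ω k ∂μ := by
    intro c s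
    rw [integral_finsetSum _ fun k _ => (hRi k).const_mul _]
    simp only [integral_const_mul]
  have hmain := psi_min (fun k => ∫ ω, R ω k ∂μ) ?_
  · simp only [hR] at hmain
    simp [psiR, integral_const_mul] at hmain
    have h8 : ∫ ω, (RCLike.re (Pc (dg K e * Om ω) i i) * RCLike.re (Pc (dg K e * Om ω) j j) +
        (RCLike.re (Pc (dg K e * Om ω) i j) ^ 2 - RCLike.im (Pc (dg K e * Om ω) i j) ^ 2)) ∂μ =
        (∫ ω, RCLike.re (Pc (dg K e * Om ω) i i) * RCLike.re (Pc (dg K e * Om ω) j j) ∂μ) +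
      ∫ ω, RCLike.re (Pc (dg K e * Om ω) i j * Pc (dg K e * Om ω) i j) ∂μ := by
      rw [← integral_add]
      · simp only [RCLike.mul_re]
        congr 1; ext ω; ring
      · exact h.integrable e he (fun P => RCLike.re (P i i) * RCLike.re (P j j)) ((cr _ _).mul (cr _ _))
      · exact h.integrable e he (fun P => RCLike.re (P i j * P i j))
          (RCLike.continuous_re.comp ((ce _ _).mul (ce _ _)))
    rw [h8] at hmain
    have hg : (e j / e i - e i / e j) * e i * e j = e j ^ 2 - e i ^ 2 := by field_simp
    linear_combination (1 / 2 : ℝ) * hmain - (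
      (∫ ω, RCLike.re (Pc (dg K e * Om ω) i i) * RCLike.re (Pc (dg K e * Om ω) j j) ∂μ) +
      ∫ ω, RCLike.re (Pc (dg K e * Om ω) i j * Pc (dg K e * Om ω) i j) ∂μ) * hg
  · intro θ
    set c := Real.cos θ
    set s := Real.sin θ
    have hcs : c ^ 2 + s ^ 2 = 1 := Real.cos_sq_add_sin_sq θ
    have hU := Rot_mem (K := K) hij c s hcs
    set y : ι → K := Pi.single i 1 + Pi.single j 1 with hy
    set f : Matrix ι ι K → ℝ := fun P => nsq (P *ᵥ (dg K e *ᵥ y)) with hf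
    have hfc : Continuous f := by
      rw [hf]; unfold nsq; fun_prop
    rw [← hsum, ← hsum]
    have h10 : ∫ ω, ∑ k, cf 1 0 k * R ω k ∂μ = ∫ ω, f (Pc (dg K e * Om ω)) ∂μ := by
      apply integral_congr_ae
      filter_upwards [h.isProj e he] with ω hω
      have := psi_ptw e he hij 1 0 (by norm_num) _ hω
      rw [hR, ← this]
      have hr : Rot K i j 1 0 = 1 := by simp [Rot]
      rw [hr]
      simp only [conjTranspose_one, one_mulVec, hf]
      congr 1
      ext k
      have hk : (e k : K) ≠ 0 := by exact_mod_cast (he k).ne'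
      rw [dg_mulVec, dg_mulVec]
      push_cast
      rw [mul_inv_cancel_left₀ hk]
    have hmf : Measurable fun O : Matrix ι κ K => f (Pc (dg K e * O)) := by
      have : BorelSpace (Matrix ι ι K) := matrixBorel
      exact hfc.measurable.comp (measurable_PE e)
    rw [h10, ← h.integral_left _ hU (fun O => f (Pc (dg K e * O))) hmf]
    apply integral_mono_ae
    · exact (h.left _ hU).integrable e he f hfc
    · exact integrable_finsetSum _ fun k _ => (hRi k).const_mul _
    · filter_upwards [h.isProj e he, h.inj] with ω hω hinj
      have := psi_ptw e he hij c s hcs _ hω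
      simp only [hR]
      rw [← this]
      exact Pc_variational e he _ hinj _ hU y

end Expect

section Expect2
variable {K : Type*} [RCLike K] [MeasurableSpace K] [BorelSpace K]
  {ι κ : Type*} [Fintype ι] [Fintype κ] [DecidableEq ι] [DecidableEq κ]
  {Y : Type*} [MeasurableSpace Y]

def phs {ι : Type*} [DecidableEq ι] (j : ι) (ζ : K) : Matrix ι ι K :=
  diagonal fun k => if k = j then ζ else 1

theorem Pc_left (Z : Matrix ι ι K) (h : Zᴴ * Z = 1) (F : Matrix ι κ K) :
    Pc (Z * F) = Z * Pc F * Zᴴ := by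
  have h' : Z * Zᴴ = 1 := mul_eq_one_comm.1 h
  have h2 : Fᴴ * Zᴴ * (Z * F) = Fᴴ * F := by
    calc _ = Fᴴ * (Zᴴ * Z) * F := by simp only [Matrix.mul_assoc]
      _ = _ := by rw [h, Matrix.mul_one]
  simp only [Pc, conjTranspose_mul, Matrix.mul_sub, Matrix.sub_mul, Matrix.mul_one, h', h2]
  simp only [Matrix.mul_assoc]

theorem phs_mul (j : ι) (ζ : K) (hζ : star ζ * ζ = 1) : (phs (ι := ι) j ζ)ᴴ * phs j ζ = 1 := by
  rw [phs, diagonal_conjTranspose, diagonal_mul_diagonal, ← diagonal_one]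
  congr 1
  ext k
  by_cases h : k = j
  · simpa [h] using hζ
  · simp [h]

theorem Pc_phs (e : ι → ℝ) (j : ι) (ζ : K) (hζ : star ζ * ζ = 1) (O : Matrix ι κ K) (k l : ι) :
    Pc (dg K e * (phs j ζ * O)) k l = (if k = j then ζ else 1) * Pc (dg K e * O) k l *
      (if l = j then star ζ else 1) := by
  have h1 : dg K e * (phs j ζ * O) = phs j ζ * (dg K e * O) := by
    rw [← Matrix.mul_assoc, ← Matrix.mul_assoc, dg, phs, diagonal_mul_diagonal, diagonal_mul_diagonal]
    simp only [mul_comm]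
  rw [h1, Pc_left _ (phs_mul j ζ hζ), phs, diagonal_conjTranspose, mul_diagonal, diagonal_mul]
  congr 1
  by_cases h : l = j <;> simp [h]

variable {μ : Measure Y} [IsProbabilityMeasure μ] {Om : Y → Matrix ι κ K}

theorem GoodEmb.ident2 (h : GoodEmb μ Om) (e : ι → ℝ) (he : ∀ i, 0 < e i) {i j : ι} (hij : i ≠ j) :
    e i ^ 2 * (∫ ω, RCLike.re (Pc (dg K e * Om ω) i i) ∂μ) -
    e j ^ 2 * (∫ ω, RCLike.re (Pc (dg K e * Om ω) j j) ∂μ) +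
    (e j ^ 2 - e i ^ 2) * (
      (∫ ω, RCLike.re (Pc (dg K e * Om ω) i i) * RCLike.re (Pc (dg K e * Om ω) j j) ∂μ) +
      alphaK K * ∫ ω, ‖Pc (dg K e * Om ω) i j‖ ^ 2 ∂μ) = 0 := by
  have key : ∀ ζ : K, star ζ * ζ = 1 →
    e i ^ 2 * (∫ ω, RCLike.re (Pc (dg K e * Om ω) i i) ∂μ) -
    e j ^ 2 * (∫ ω, RCLike.re (Pc (dg K e * Om ω) j j) ∂μ) +
    (e j / e i - e i / e j) * (
     e i ^ 2 * (∫ ω, RCLike.re (Pc (dg K e * Om ω) i i) * RCLike.re (Pc (dg K e * Om ω) i j * star ζ) ∂μ) +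
     e j ^ 2 * (∫ ω, RCLike.re (Pc (dg K e * Om ω) j j) * RCLike.re (Pc (dg K e * Om ω) i j * star ζ) ∂μ)) +
    (e j ^ 2 - e i ^ 2) * (
      (∫ ω, RCLike.re (Pc (dg K e * Om ω) i i) * RCLike.re (Pc (dg K e * Om ω) j j) ∂μ) +
      ∫ ω, RCLike.re ((star ζ * star ζ) * (Pc (dg K e * Om ω) i j * Pc (dg K e * Om ω) i j)) ∂μ) = 0 := by
    intro ζ hζ
    have hU : phs (ι := ι) j ζ ∈ unitaryGroup ι K := by
      rw [Matrix.mem_unitaryGroup_iff', star_eq_conjTranspose, phs_mul j ζ hζ]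
    have := (h.left _ hU).ident1 e he hij
    have e1 : ∀ O : Matrix ι κ K, Pc (dg K e * (phs j ζ * O)) i i = Pc (dg K e * O) i i := by
      intro O; rw [Pc_phs e j ζ hζ]; simp [hij]
    have e2 : ∀ O : Matrix ι κ K, Pc (dg K e * (phs j ζ * O)) j j = Pc (dg K e * O) j j := by
      intro O; rw [Pc_phs e j ζ hζ]
      simp only [if_true]
      linear_combination Pc (dg K e * O) j j * hζ
    have e3 : ∀ O : Matrix ι κ K, Pc (dg K e * (phs j ζ * O)) i j = Pc (dg K e * O) i j * star ζ := by
      intro O; rw [Pc_phs e j ζ hζ]; simp [hij]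
    simp only [e1, e2, e3] at this
    rw [← this]
    congr 3
    congr 1; ext ω; congr 1; ring
  have k1 := key 1 (by simp)
  have k2 := key (-1) (by simp)
  by_cases hI : (RCLike.I : K) = 0
  · have ha : alphaK K = 1 := by simp [alphaK, hI]
    have hsq : ∀ z : K, RCLike.re (z * z) = ‖z‖ ^ 2 := by
      intro z
      have him : RCLike.im z = 0 := by
        have := RCLike.mul_im_I_ax z
        rw [hI] at this
        simpa using this.symm
      rw [RCLike.norm_sq_eq_def, RCLike.mul_re, him]; ring
    rw [ha]
    simp [hsq, integral_neg] at k1 k2 ⊢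
    linarith
  · have ha : alphaK K = 0 := by simp [alphaK, hI]
    have hII : (RCLike.I : K) * RCLike.I = -1 := RCLike.I_mul_I_of_nonzero hI
    have k3 := key RCLike.I (by simp [hII])
    have k4 := key (-RCLike.I) (by simp [hII])
    rw [ha]
    simp [hII, integral_neg] at k1 k2 k3 k4 ⊢
    have hneg : ∫ ω, (RCLike.im (Pc (dg K e * Om ω) i j) * RCLike.im (Pc (dg K e * Om ω) i j) -
        RCLike.re (Pc (dg K e * Om ω) i j) * RCLike.re (Pc (dg K e * Om ω) i j)) ∂μ =
        -∫ ω, (RCLike.re (Pc (dg K e * Om ω) i j) * RCLike.re (Pc (dg K e * Om ω) i j) -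
        RCLike.im (Pc (dg K e * Om ω) i j) * RCLike.im (Pc (dg K e * Om ω) i j)) ∂μ := by
      rw [← integral_neg]
      congr 1; ext ω; ring
    rw [hneg] at k3 k4
    linarith

end Expect2

section Comb

theorem comb_bound {ι : Type*} [Fintype ι] [DecidableEq ι] (s p : ι → ℝ) (m : ι → ι → ℝ)
    (hs : ∀ i, 0 < s i) (T : Finset ι) (k α r q l : ℝ)
    (h1 : ∀ i j, i ≠ j → s i * p i - s j * p j + (s j - s i) * m i j = 0)
    (h2 : ∀ i j, i ≠ j → 0 ≤ p i + p j - 2 * m i j)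
    (h3 : ∀ i ∈ T, ∑ j ∈ Tᶜ, m i j ≤ (k + α) * p i)
    (h4 : ∀ i j, 0 ≤ m i j) (h5 : ∀ i, 0 ≤ p i) (h6 : ∑ j ∈ Tᶜ, p j ≤ k)
    (hq : (T.card : ℝ) = q) (hr : (Tᶜ.card : ℝ) = r - q) (hl : l = r - k)
    (hql : q < l - α) (hqr : q < r) :
    ∑ i, s i * p i ≤ k / (r - q) * ((1 + q / (l - q - α)) * ∑ j ∈ Tᶜ, s j) := by
  have hnn : ∀ i j, i ≠ j → 0 ≤ p i - m i j := by
    intro i j hij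
    have e1 : s i * (p i - m i j) = s j * (p j - m i j) := by linarith [h1 i j hij]
    have e2 := h2 i j hij
    by_contra hneg
    push Not at hneg
    have : 0 < p j - m i j := by linarith
    have a1 := mul_pos (hs j) this
    have a2 := mul_neg_of_pos_of_neg (hs i) hneg
    linarith
  have hanti : AntivaryOn s p (Tᶜ : Finset ι) := by
    intro i _ j _ hlt
    have hij : i ≠ j := by rintro rfl; exact lt_irrefl _ hlt
    by_contra hneg
    push Not at hneg
    have e1 : s i * (p i - m i j) = s j * (p j - m i j) := by linarith [h1 i j hij]
    have a1 := hnn i j hij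
    have : s i * (p i - m i j) < s j * (p j - m i j) := by
      nlinarith [hs i, hs j]
    linarith
  have hcheb := hanti.card_mul_sum_le_sum_mul_sum
  rw [hr] at hcheb
  have hk : 0 ≤ k := le_trans (Finset.sum_nonneg fun j _ => h5 j) h6
  have hS : 0 ≤ ∑ j ∈ Tᶜ, s j := Finset.sum_nonneg fun j _ => (hs j).le
  set A := ∑ i ∈ T, s i * p i with hA
  set B := ∑ j ∈ Tᶜ, s j * p j with hB
  have hB0 : 0 ≤ B := Finset.sum_nonneg fun j _ => mul_nonneg (hs j).le (h5 j)
  have hBle : B ≤ k / (r - q) * ∑ j ∈ Tᶜ, s j := by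
    have hrq : 0 < r - q := by linarith
    rw [div_mul_eq_mul_div, le_div_iff₀ hrq]
    have := mul_le_mul_of_nonneg_left h6 hS
    linarith
  have hAB : (l - q - α) * A ≤ q * B := by
    have hdouble : ∑ i ∈ T, ∑ j ∈ Tᶜ, (s i * p i - s j * p j + (s j - s i) * m i j) = 0 := by
      refine Finset.sum_eq_zero fun i hi => Finset.sum_eq_zero fun j hj => h1 i j ?_
      rintro rfl
      exact (Finset.mem_compl.1 hj) hi
    have e1 : ∑ i ∈ T, ∑ j ∈ Tᶜ, s i * p i = (r - q) * A := by
      simp only [Finset.sum_const, nsmul_eq_mul, hr, ← Finset.mul_sum, hA]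
    have e2 : ∑ i ∈ T, ∑ j ∈ Tᶜ, s j * p j = q * B := by
      simp only [Finset.sum_const, nsmul_eq_mul, hq, hB]
    have e3 : 0 ≤ ∑ i ∈ T, ∑ j ∈ Tᶜ, s j * m i j :=
      Finset.sum_nonneg fun i _ => Finset.sum_nonneg fun j _ => mul_nonneg (hs j).le (h4 i j)
    have e4 : ∑ i ∈ T, ∑ j ∈ Tᶜ, s i * m i j ≤ (k + α) * A := by
      rw [hA, Finset.mul_sum]
      refine Finset.sum_le_sum fun i hi => ?_
      rw [← Finset.mul_sum]
      have := mul_le_mul_of_nonneg_left (h3 i hi) (hs i).le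
      linarith
    simp only [sub_mul, Finset.sum_add_distrib, Finset.sum_sub_distrib, e1, e2] at hdouble
    rw [hl]
    linarith
  have hpos : 0 < l - q - α := by linarith
  have htot : ∑ i, s i * p i = A + B := (Finset.sum_add_sum_compl T _).symm
  have hA2 : A ≤ q / (l - q - α) * B := by
    rw [div_mul_eq_mul_div, le_div_iff₀ hpos]; linarith
  have hq0 : 0 ≤ q := by rw [← hq]; positivity
  have hc : 0 ≤ 1 + q / (l - q - α) := by positivity
  calc ∑ i, s i * p i ≤ (1 + q / (l - q - α)) * B := by rw [htot]; linarith
    _ ≤ (1 + q / (l - q - α)) * (k / (r - q) * ∑ j ∈ Tᶜ, s j) := mul_le_mul_of_nonneg_left hBle hc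
    _ = _ := by ring

theorem alphaK_nonneg (K : Type*) [RCLike K] : 0 ≤ alphaK K := by
  unfold alphaK; split_ifs <;> norm_num

theorem alphaK_le (K : Type*) [RCLike K] : alphaK K ≤ 1 := by
  unfold alphaK; split_ifs <;> norm_num

variable {K : Type*} [RCLike K] [MeasurableSpace K] [BorelSpace K]
  {ι κ : Type*} [Fintype ι] [Fintype κ] [DecidableEq ι] [DecidableEq κ]
  {Y : Type*} [MeasurableSpace Y]
variable {μ : Measure Y} [IsProbabilityMeasure μ] {Om : Y → Matrix ι κ K}

theorem GoodEmb.bound (h : GoodEmb μ Om) (e : ι → ℝ) (he : ∀ i, 0 < e i) (T : Finset ι)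
    (hq : (T.card : ℝ) < Fintype.card κ - alphaK K) (hκ : Fintype.card κ ≤ Fintype.card ι) :
    ∫ ω, ∑ i, e i ^ 2 * RCLike.re (Pc (dg K e * Om ω) i i) ∂μ ≤
      ((Fintype.card ι : ℝ) - Fintype.card κ) / ((Fintype.card ι : ℝ) - T.card) *
      ((1 + T.card / ((Fintype.card κ : ℝ) - T.card - alphaK K)) * ∑ j ∈ Tᶜ, e j ^ 2) := by
  set P : Y → Matrix ι ι K := fun ω => Pc (dg K e * Om ω) with hPdef
  have hproj : ∀ᵐ ω ∂μ, IsProj (P ω) := h.isProj e he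
  have ce : ∀ k l : ι, Continuous fun P : Matrix ι ι K => P k l := fun k l => continuous_id.matrix_elem k l
  have cr : ∀ k l : ι, Continuous fun P : Matrix ι ι K => RCLike.re (P k l) :=
    fun k l => RCLike.continuous_re.comp (ce k l)
  have ii : ∀ i, Integrable (fun ω => RCLike.re (P ω i i)) μ := fun i => h.integrable e he _ (cr i i)
  have iij : ∀ i j, Integrable (fun ω => RCLike.re (P ω i i) * RCLike.re (P ω j j)) μ :=
    fun i j => h.integrable e he _ ((cr i i).mul (cr j j))
  have inn : ∀ i j, Integrable (fun ω => ‖P ω i j‖ ^ 2) μ :=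
    fun i j => h.integrable e he (fun P => ‖P i j‖ ^ 2) ((ce i j).norm.pow 2)
  have ha0 := alphaK_nonneg K
  have ha1 := alphaK_le K
  set α := alphaK K
  set k : ℝ := (Fintype.card ι : ℝ) - Fintype.card κ with hk
  have htr : ∀ᵐ ω ∂μ, ∑ i, RCLike.re (P ω i i) = k := by
    filter_upwards [h.inj] with ω hω
    have := Pc_trace _ (isUnit_gram (dg_inj e he _ hω))
    have h2 := congrArg RCLike.re this
    simpa [Matrix.trace, hPdef, hk] using h2
  have hdiag : ∀ᵐ ω ∂μ, ∀ i, 0 ≤ RCLike.re (P ω i i) := by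
    filter_upwards [hproj] with ω hω i
    rw [← hω.sum_row]
    exact Finset.sum_nonneg fun _ _ => by positivity
  have hpair : ∀ᵐ ω ∂μ, ∀ i j, i ≠ j → RCLike.re (P ω i i) ^ 2 + ‖P ω i j‖ ^ 2 ≤ RCLike.re (P ω i i) := by
    filter_upwards [hproj] with ω hω i j hij
    have h1 := hω.sum_row i
    have h2 : ∑ l ∈ {i, j}, ‖P ω i l‖ ^ 2 ≤ ∑ l, ‖P ω i l‖ ^ 2 :=
      Finset.sum_le_sum_of_subset_of_nonneg (Finset.subset_univ _) (fun _ _ _ => by positivity)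
    rw [Finset.sum_pair hij, h1] at h2
    have h3 : RCLike.re (P ω i i) ^ 2 ≤ ‖P ω i i‖ ^ 2 := by
      rw [RCLike.norm_sq_eq_def]; nlinarith [mul_self_nonneg (RCLike.im (P ω i i))]
    linarith
  have him : ∀ i j, Integrable (fun ω => RCLike.re (P ω i i) * RCLike.re (P ω j j) + α * ‖P ω i j‖ ^ 2) μ :=
    fun i j => (iij i j).add ((inn i j).const_mul α)
  have hm : ∀ i j, (∫ ω, (RCLike.re (P ω i i) * RCLike.re (P ω j j) + α * ‖P ω i j‖ ^ 2) ∂μ) =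
      (∫ ω, RCLike.re (P ω i i) * RCLike.re (P ω j j) ∂μ) + α * ∫ ω, ‖P ω i j‖ ^ 2 ∂μ := by
    intro i j
    rw [integral_add (iij i j) ((inn i j).const_mul α), integral_const_mul]
  rw [integral_finsetSum _ fun i _ => (ii i).const_mul _]
  simp only [integral_const_mul]
  refine comb_bound (fun i => e i ^ 2) (fun i => ∫ ω, RCLike.re (P ω i i) ∂μ)
    (fun i j => ∫ ω, (RCLike.re (P ω i i) * RCLike.re (P ω j j) + α * ‖P ω i j‖ ^ 2) ∂μ)
    (fun i => by have := he i; positivity) T k α _ _ _ ?_ ?_ ?_ ?_ ?_ ?_ rfl ?_ ?_ hq ?_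
  · intro i j hij
    beta_reduce
    rw [hm]
    exact h.ident2 e he hij
  · intro i j hij
    have hadd : Integrable (fun ω => RCLike.re (P ω i i) + RCLike.re (P ω j j)) μ := (ii i).add (ii j)
    rw [← integral_add (ii i) (ii j), ← integral_const_mul,
      ← integral_sub hadd ((him i j).const_mul 2)]
    apply integral_nonneg_of_ae
    filter_upwards [hpair, hproj] with ω hω hp
    have h1 := hω i j hij
    have h2 := hω j i hij.symm
    have h3 : ‖P ω j i‖ = ‖P ω i j‖ := by rw [herm_apply hp.herm i j, norm_star]
    rw [h3] at h2
    simp only [Pi.zero_apply]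
    have h4 : α * ‖P ω i j‖ ^ 2 ≤ ‖P ω i j‖ ^ 2 := by nlinarith [sq_nonneg ‖P ω i j‖]
    nlinarith [sq_nonneg (RCLike.re (P ω i i) - RCLike.re (P ω j j))]
  · intro i hi
    rw [← integral_finsetSum _ fun j _ => him i j, ← integral_const_mul]
    apply integral_mono_ae (integrable_finsetSum _ fun j _ => him i j) ((ii i).const_mul _)
    filter_upwards [hdiag, hproj, htr] with ω hd hp ht
    simp only [Finset.sum_add_distrib, ← Finset.mul_sum]
    have h1 : ∑ j ∈ Tᶜ, RCLike.re (P ω j j) ≤ k := by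
      rw [← ht]
      exact Finset.sum_le_sum_of_subset_of_nonneg (Finset.subset_univ _) (fun j _ _ => hd j)
    have h2 : ∑ j ∈ Tᶜ, ‖P ω i j‖ ^ 2 ≤ RCLike.re (P ω i i) := by
      rw [← hp.sum_row i]
      exact Finset.sum_le_sum_of_subset_of_nonneg (Finset.subset_univ _) (fun _ _ _ => by positivity)
    have h3 := mul_le_mul_of_nonneg_left h1 (hd i)
    have h4 := mul_le_mul_of_nonneg_left h2 ha0
    linarith
  · intro i j
    apply integral_nonneg_of_ae
    filter_upwards [hdiag] with ω hd
    exact add_nonneg (mul_nonneg (hd i) (hd j)) (mul_nonneg ha0 (by positivity))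
  · intro i
    apply integral_nonneg_of_ae
    filter_upwards [hdiag] with ω hd
    exact hd i
  · rw [← integral_finsetSum _ fun j _ => ii j]
    have : k = ∫ _ω, k ∂μ := by simp
    rw [this]
    apply integral_mono_ae (integrable_finsetSum _ fun j _ => ii j) (integrable_const _)
    filter_upwards [hdiag, htr] with ω hd ht
    rw [← ht]
    exact Finset.sum_le_sum_of_subset_of_nonneg (Finset.subset_univ _) (fun j _ _ => hd j)
  · rw [Finset.card_compl, Nat.cast_sub (Finset.card_le_univ T)]
  · rw [hk]; ring
  · have : (Fintype.card κ : ℝ) ≤ Fintype.card ι := by exact_mod_cast hκ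
    linarith

end Comb

section RankLemma
variable {K : Type*} [RCLike K] {ι κ : Type*} [Fintype ι] [Fintype κ] [DecidableEq ι] [DecidableEq κ]

/-- Householder reflection in the real vector `w`. -/
def House (K : Type*) [RCLike K] {ι : Type*} [Fintype ι] [DecidableEq ι] (w : ι → ℝ) : Matrix ι ι K :=
  1 - (2 / ((∑ i, w i ^ 2 : ℝ) : K)) • vecMulVec (fun i => (w i : K)) (fun i => (w i : K))

theorem House_mulVec (w : ι → ℝ) (y : ι → K) (i : ι) :
    (House K w *ᵥ y) i = y i - 2 / ((∑ i, w i ^ 2 : ℝ) : K) * ((w i : K) * ∑ k, (w k : K) * y k) := by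
  simp [House, sub_mulVec, smul_mulVec, vecMulVec_mulVec, dotProduct]

theorem House_invol (w : ι → ℝ) (hw : ∑ i, w i ^ 2 ≠ 0) : House K w * House K w = 1 := by
  have hs : ((∑ i, w i ^ 2 : ℝ) : K) ≠ 0 := by exact_mod_cast hw
  have hd : (fun i => (w i : K)) ⬝ᵥ (fun i => (w i : K)) = ((∑ i, w i ^ 2 : ℝ) : K) := by
    simp [dotProduct, sq]
  unfold House
  set v : ι → K := fun i => (w i : K)
  set s : K := ((∑ i, w i ^ 2 : ℝ) : K)
  rw [Matrix.sub_mul, Matrix.mul_sub, Matrix.one_mul, Matrix.mul_sub, Matrix.mul_one, Matrix.one_mul,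
    Matrix.smul_mul, Matrix.mul_smul, vecMulVec_mul_vecMulVec, hd]
  ext i j
  simp [vecMulVec_apply]
  field_simp
  ring

theorem House_mem (w : ι → ℝ) (hw : ∑ i, w i ^ 2 ≠ 0) : House K w ∈ unitaryGroup ι K := by
  rw [Matrix.mem_unitaryGroup_iff]
  have : star (House K w) = House K w := by
    rw [star_eq_conjTranspose]
    unfold House
    generalize (∑ i, w i ^ 2) = s
    ext i j
    have h2 : (starRingEnd K) (2 / (s : K)) = 2 / (s : K) := by
      rw [map_div₀, RCLike.conj_ofReal, map_ofNat]
    simp only [Matrix.sub_apply, Matrix.smul_apply, vecMulVec_apply, conjTranspose_apply, Matrix.one_apply, star_sub,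
      smul_eq_mul, RCLike.star_def, map_mul, h2, RCLike.conj_ofReal, eq_comm, apply_ite, map_one, map_zero]
    by_cases hij : i = j
    · subst hij; simp
    · have hji : ¬ j = i := fun h => hij h.symm
      simp [hij, hji, mul_comm]
  rw [this, House_invol w hw]

def Bad (J : Finset ι) (O : Matrix ι κ K) : Prop := ∃ x, x ≠ 0 ∧ ∀ i ∈ J, (O *ᵥ x) i = 0

theorem bad_iff (J : Finset ι) (O : Matrix ι κ K) : Bad J O ↔
    ((Matrix.diagonal (fun i => if i ∈ J then (1 : K) else 0) * O)ᴴ *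
      (Matrix.diagonal (fun i => if i ∈ J then (1 : K) else 0) * O)).det = 0 := by
  have key : ∀ x, (Matrix.diagonal (fun i => if i ∈ J then (1 : K) else 0) * O) *ᵥ x = 0 ↔
      ∀ i ∈ J, (O *ᵥ x) i = 0 := by
    intro x
    rw [← mulVec_mulVec, funext_iff]
    simp [mulVec_diagonal]
  constructor
  · rintro ⟨x, hx, h⟩
    by_contra hne
    exact hx (gram_inj (isUnit_iff_ne_zero.2 hne) x ((key x).2 h))
  · intro h
    by_contra hb
    have := isUnit_gram (F := Matrix.diagonal (fun i => if i ∈ J then (1 : K) else 0) * O) (fun x hx => by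
      by_contra hx0
      exact hb ⟨x, hx0, (key x).1 hx⟩)
    exact this.ne_zero h

theorem bad_poly (J : Finset ι) (j : ι) (hj : j ∉ J) (O : Matrix ι κ K) (hO : ¬ Bad (insert j J) O)
    (hc : Fintype.card κ ≤ J.card) (a : ι → ℕ) (ha : Function.Injective a) (haj : a j = 0) (N : ℕ)
    (haN : ∀ i, a i ≤ N) :
    ∃ Q : Polynomial K, Q ≠ 0 ∧ Q.natDegree ≤ 2 * N ∧ ∀ t : ℕ,
      Bad J (House K (fun i => if i ∈ insert j J then (t : ℝ) ^ a i else 0) * O) → Q.eval (t : K) = 0 := by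
  obtain ⟨J', hJ'⟩ : ∃ J', J' = insert j J := ⟨_, rfl⟩
  rw [← hJ'] at hO ⊢
  obtain ⟨c0, hc0, hc0'⟩ : ∃ c : {i // i ∈ J'} → K, c ≠ 0 ∧
      (O.submatrix Subtype.val id)ᵀ *ᵥ c = 0 := by
    have hlt : Module.finrank K (κ → K) < Module.finrank K ({i // i ∈ J'} → K) := by
      simp only [hJ', Module.finrank_fintype_fun_eq_card, Fintype.card_coe, Finset.card_insert_of_notMem hj]
      omega
    have := LinearMap.ker_ne_bot_of_finrank_lt (f := (O.submatrix (Subtype.val : {i // i ∈ J'} → ι) id)ᵀ.mulVecLin) hlt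
    obtain ⟨c, hc, hc'⟩ := (Submodule.ne_bot_iff _).1 this
    exact ⟨c, hc', by simpa using hc⟩
  have hjJ' : j ∈ J' := hJ' ▸ Finset.mem_insert_self _ _
  set c : ι → K := fun i => if h : i ∈ J' then c0 ⟨i, h⟩ else 0 with hcdef
  have hcz : ∀ x, ∑ i ∈ J', c i * (O *ᵥ x) i = 0 := by
    intro x
    rw [← Finset.sum_coe_sort]
    have h1 : ((O.submatrix (Subtype.val : {i // i ∈ J'} → ι) id)ᵀ *ᵥ c0) ⬝ᵥ x = 0 := by
      rw [hc0']; simp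
    rw [mulVec_transpose, ← dotProduct_mulVec] at h1
    rw [← h1]
    simp only [dotProduct]
    refine Finset.sum_congr rfl fun i _ => ?_
    simp [hcdef, mulVec, dotProduct]
  have hcne : ∃ i ∈ J', c i ≠ 0 := by
    by_contra hno
    push Not at hno
    apply hc0
    ext ⟨i, hi⟩
    have := hno i hi
    simpa [hcdef, hi] using this
  let Q : Polynomial K := Polynomial.C (c j) * ∑ i ∈ J', Polynomial.X ^ (2 * a i) -
    Polynomial.C 2 * ∑ i ∈ J', Polynomial.C (c i) * Polynomial.X ^ (a i)
  refine ⟨Q, ?_, ?_, ?_⟩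
  · intro hQ
    have hcoef : ∀ m, c j * (∑ i ∈ J', if m = 2 * a i then (1 : K) else 0) -
        2 * ∑ i ∈ J', (if m = a i then c i else 0) = 0 := by
      intro m
      have := congrArg (fun p => Polynomial.coeff p m) hQ
      simpa [Q, Polynomial.finsetSum_coeff, Polynomial.coeff_X_pow, Polynomial.coeff_C_mul] using this
    have hs : ∀ i ∈ J', ∑ k ∈ J', (if a i = a k then c k else 0) = c i := by
      intro i hi
      rw [Finset.sum_eq_single i]
      · simp
      · intro k _ hk
        rw [if_neg fun h => hk (ha h).symm]
      · exact fun h => absurd hi h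
    have hcj : c j = 0 := by
      have h0 := hcoef (a j)
      rw [hs j hjJ', Finset.sum_eq_single j] at h0
      · simp [haj] at h0
        linear_combination -h0
      · intro k _ hk
        rw [if_neg]
        intro h
        apply hk
        apply ha
        omega
      · exact fun h => absurd hjJ' h
    obtain ⟨i, hi, hne⟩ := hcne
    have h1 := hcoef (a i)
    rw [hs i hi, hcj] at h1
    simp at h1
    exact hne h1
  · refine (Polynomial.natDegree_sub_le _ _).trans (max_le ?_ ?_)
    · refine (Polynomial.natDegree_C_mul_le _ _).trans (Polynomial.natDegree_sum_le_of_forall_le _ _ fun i _ => ?_)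
      rw [Polynomial.natDegree_X_pow]
      have := haN i
      omega
    · refine (Polynomial.natDegree_C_mul_le _ _).trans (Polynomial.natDegree_sum_le_of_forall_le _ _ fun i _ => ?_)
      refine (Polynomial.natDegree_C_mul_X_pow_le _ _).trans ?_
      have := haN i
      omega
  · intro t hbad
    set w : ι → ℝ := fun i => if i ∈ J' then (t : ℝ) ^ a i else 0 with hw
    have hwj : w j = 1 := by simp [hw, hjJ', haj]
    have hwne : ∑ i, w i ^ 2 ≠ 0 := by
      have : w j ^ 2 ≤ ∑ i, w i ^ 2 := Finset.single_le_sum (fun i _ => sq_nonneg (w i)) (Finset.mem_univ j)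
      rw [hwj] at this
      linarith
    obtain ⟨x, hx, hy⟩ := hbad
    set y := (House K w * O) *ᵥ x with hydef
    have hz : O *ᵥ x = House K w *ᵥ y := by
      rw [hydef, mulVec_mulVec, ← Matrix.mul_assoc, House_invol w hwne, Matrix.one_mul]
    have hsum : ∑ k, (w k : K) * y k = y j := by
      rw [Finset.sum_eq_single j]
      · simp [hwj]
      · intro k _ hk
        by_cases hkJ : k ∈ J
        · rw [hy k hkJ, mul_zero]
        · have : w k = 0 := by simp [hw, hJ', hk, hkJ]
          simp [this]
      · simp
    have hyj : y j ≠ 0 := by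
      intro h0
      apply hO
      refine ⟨x, hx, fun i hi => ?_⟩
      rw [hz, House_mulVec, hsum, h0]
      rcases Finset.mem_insert.1 (hJ' ▸ hi) with rfl | hi
      · simp [h0]
      · simp [hy i hi]
    have hsne : ((∑ i, w i ^ 2 : ℝ) : K) ≠ 0 := by exact_mod_cast hwne
    have h1 := hcz x
    rw [hz] at h1
    simp only [House_mulVec, hsum] at h1
    have h2 : ∑ i ∈ J', c i * y i = c j * y j := by
      rw [Finset.sum_eq_single j]
      · intro k hk hkj
        rw [hy k ((Finset.mem_insert.1 (hJ' ▸ hk)).resolve_left hkj), mul_zero]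
      · exact fun h => absurd hjJ' h
    have h3 : c j * y j - 2 / ((∑ i, w i ^ 2 : ℝ) : K) * y j * ∑ i ∈ J', c i * (w i : K) = 0 := by
      rw [← h1, ← h2, Finset.mul_sum, ← Finset.sum_sub_distrib]
      refine Finset.sum_congr rfl fun i _ => ?_
      ring
    have h4 : c j * ((∑ i, w i ^ 2 : ℝ) : K) - 2 * ∑ i ∈ J', c i * (w i : K) = 0 := by
      have : y j * (c j * ((∑ i, w i ^ 2 : ℝ) : K) - 2 * ∑ i ∈ J', c i * (w i : K)) = 0 := by
        field_simp at h3
        linear_combination h3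
      exact (mul_eq_zero.1 this).resolve_left hyj
    have h5 : ((∑ i, w i ^ 2 : ℝ) : K) = ∑ i ∈ J', (t : K) ^ (2 * a i) := by
      simp [hw, ite_pow, Finset.sum_ite_mem, ← pow_mul, mul_comm]
    have h6 : ∑ i ∈ J', c i * (w i : K) = ∑ i ∈ J', c i * (t : K) ^ a i := by
      refine Finset.sum_congr rfl fun i hi => ?_
      simp [hw, hi]
    rw [h5, h6] at h4
    simpa [Q, Polynomial.eval_finsetSum] using h4

variable [MeasurableSpace K] [BorelSpace K] {Y : Type*} [MeasurableSpace Y]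
variable {μ : Measure Y} [IsProbabilityMeasure μ] {Om : Y → Matrix ι κ K}

theorem measurableSet_bad (J : Finset ι) : MeasurableSet {O : Matrix ι κ K | Bad J O} := by
  have : BorelSpace (Matrix ι κ K) := matrixBorel
  simp only [bad_iff]
  apply IsClosed.measurableSet
  apply isClosed_eq _ continuous_const
  fun_prop

theorem GoodEmb.step (h : GoodEmb μ Om) (J : Finset ι) (j : ι) (hj : j ∉ J)
    (hc : Fintype.card κ ≤ J.card) (hJ : ∀ᵐ ω ∂μ, ¬ Bad (insert j J) (Om ω)) :
    ∀ᵐ ω ∂μ, ¬ Bad J (Om ω) := by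
  classical
  let a : ι → ℕ := fun i => if i = j then 0 else (Fintype.equivFin ι i : ℕ) + 1
  have ha : Function.Injective a := by
    intro i k hik
    simp only [a] at hik
    split_ifs at hik with h1 h2 h2
    · rw [h1, h2]
    · have : (Fintype.equivFin ι i) = (Fintype.equivFin ι k) := by
        apply Fin.ext; omega
      exact (Fintype.equivFin ι).injective this
  have haj : a j = 0 := by simp [a]
  have haN : ∀ i, a i ≤ Fintype.card ι := by
    intro i
    simp only [a]
    split_ifs
    · omega
    · have := (Fintype.equivFin ι i).2
      omega
  set N := Fintype.card ι
  set H : ℕ → Matrix ι ι K := fun t => House K (fun i => if i ∈ insert j J then (t : ℝ) ^ a i else 0) with hH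
  have hHU : ∀ t, H t ∈ unitaryGroup ι K := by
    intro t
    apply House_mem
    have : (1 : ℝ) ≤ ∑ i, (if i ∈ insert j J then (t : ℝ) ^ a i else 0) ^ 2 := by
      refine le_trans ?_ (Finset.single_le_sum (f := fun i => (if i ∈ insert j J then (t : ℝ) ^ a i else 0) ^ 2)
        (fun i _ => sq_nonneg _) (Finset.mem_univ j))
      simp [haj]
    linarith
  let B : ℕ → Set Y := fun t => {ω | Bad J (H t * Om ω)}
  have hBm : ∀ t, MeasurableSet (B t) := fun t => (h.left (H t) (hHU t)).meas (measurableSet_bad J)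
  have hBμ : ∀ t, μ (B t) = μ {ω | Bad J (Om ω)} := by
    intro t
    have h1 := Measure.map_apply (μ := μ) (h.left (H t) (hHU t)).meas (measurableSet_bad J)
    rw [h.rot _ (hHU t), Measure.map_apply h.meas (measurableSet_bad J)] at h1
    exact h1.symm
  have hcount : ∀ᵐ ω ∂μ, ∀ m : ℕ, ∑ t ∈ Finset.range m, (B t).indicator (1 : Y → ℝ≥0∞) ω ≤ (2 * N : ℕ) := by
    filter_upwards [hJ] with ω hω m
    obtain ⟨Q, hQ0, hQd, hQ⟩ := bad_poly J j hj (Om ω) hω hc a ha haj N haN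
    have e1 : ∑ t ∈ Finset.range m, (B t).indicator (1 : Y → ℝ≥0∞) ω =
        (((Finset.range m).filter fun t => ω ∈ B t).card : ℕ) := by
      simp [Set.indicator_apply, Finset.sum_ite]
    rw [e1]
    norm_cast
    have e2 : ((Finset.range m).filter fun t => ω ∈ B t).card ≤ Q.roots.toFinset.card := by
      apply Finset.card_le_card_of_injOn (fun t : ℕ => (t : K))
      · intro t ht
        have ht' := (Finset.mem_filter.1 ht).2
        simp only [Finset.mem_coe, Multiset.mem_toFinset, Polynomial.mem_roots hQ0, Polynomial.IsRoot.def]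
        exact hQ t ht'
      · intro s _ t _ hst
        exact Nat.cast_injective (R := K) hst
    exact e2.trans ((Multiset.toFinset_card_le _).trans ((Polynomial.card_roots' Q).trans hQd))
  have hle : ∀ m : ℕ, (m : ℝ≥0∞) * μ {ω | Bad J (Om ω)} ≤ (2 * N : ℕ) := by
    intro m
    calc (m : ℝ≥0∞) * μ {ω | Bad J (Om ω)} = ∑ t ∈ Finset.range m, μ (B t) := by
          simp [hBμ]
      _ = ∫⁻ ω, ∑ t ∈ Finset.range m, (B t).indicator (1 : Y → ℝ≥0∞) ω ∂μ := by
          rw [lintegral_finsetSum _ fun t _ => (measurable_one.indicator (hBm t))]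
          exact Finset.sum_congr rfl fun t _ => (lintegral_indicator_one (hBm t)).symm
      _ ≤ ∫⁻ _ω, ((2 * N : ℕ) : ℝ≥0∞) ∂μ := by
          apply lintegral_mono_ae
          filter_upwards [hcount] with ω hω using hω m
      _ = _ := by simp
  rw [ae_iff]
  simp only [not_not]
  by_contra hne
  obtain ⟨m, hm⟩ := ENNReal.exists_nat_mul_gt hne (ENNReal.natCast_ne_top (2 * N))
  exact absurd (hle m) (not_le.2 hm)

theorem GoodEmb.rows (h : GoodEmb μ Om) (J : Finset ι) (hc : Fintype.card κ ≤ J.card) :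
    ∀ᵐ ω ∂μ, ¬ Bad J (Om ω) := by
  obtain ⟨m, hm⟩ : ∃ m, Jᶜ.card = m := ⟨_, rfl⟩
  induction m generalizing J with
  | zero =>
    have : J = Finset.univ := by simpa using hm
    subst this
    filter_upwards [h.inj] with ω hω
    rintro ⟨x, hx, hx0⟩
    exact hx (hω x (funext fun i => hx0 i (Finset.mem_univ i)))
  | succ m ih =>
    obtain ⟨j, hj⟩ : Jᶜ.Nonempty := by rw [← Finset.card_pos]; omega
    have hj' : j ∉ J := Finset.mem_compl.1 hj
    refine h.step J j hj' hc (ih (insert j J) ?_ ?_)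
    · rw [Finset.card_insert_of_notMem hj']; omega
    · rw [Finset.compl_insert, Finset.card_erase_of_mem hj]; omega

end RankLemma

section EY
variable {K : Type*} [RCLike K] {m n : Type*} [Fintype m] [Fintype n] [DecidableEq n]

theorem top_sum {ι : Type*} [Fintype ι] [DecidableEq ι] (s h : ι → ℝ) (hs : ∀ i, 0 ≤ s i)
    (h0 : ∀ i, 0 ≤ h i) (h1 : ∀ i, h i ≤ 1) (q : ℕ) (hq : ∑ i, h i ≤ q) (hc : q ≤ Fintype.card ι) :
    ∃ T : Finset ι, T.card = q ∧ ∑ j ∈ Tᶜ, s j ≤ ∑ i, s i * (1 - h i) := by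
  have hne : (Finset.powersetCard q (Finset.univ : Finset ι)).Nonempty :=
    Finset.powersetCard_nonempty.2 (by simpa using hc)
  obtain ⟨T, hT, hmax⟩ := Finset.exists_max_image _ (fun T : Finset ι => ∑ i ∈ T, s i) hne
  have hTq : T.card = q := (Finset.mem_powersetCard.1 hT).2
  refine ⟨T, hTq, ?_⟩
  have hswap : ∀ i ∈ T, ∀ j ∉ T, s j ≤ s i := by
    intro i hi j hj
    have hj' : j ∉ T.erase i := fun h => hj (Finset.mem_of_mem_erase h)
    have hpos : 0 < T.card := Finset.card_pos.2 ⟨i, hi⟩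
    have := hmax (insert j (T.erase i)) (Finset.mem_powersetCard.2 ⟨Finset.subset_univ _, by
      rw [Finset.card_insert_of_notMem hj', Finset.card_erase_of_mem hi]; omega⟩)
    rw [Finset.sum_insert hj', ← Finset.add_sum_erase T s hi] at this
    linarith
  obtain ⟨τ, hτ0, hτ1, hτ2⟩ : ∃ τ : ℝ, 0 ≤ τ ∧ (∀ i ∈ T, τ ≤ s i) ∧ ∀ j ∉ T, s j ≤ τ := by
    rcases T.eq_empty_or_nonempty with rfl | hTn
    · refine ⟨∑ i, s i, Finset.sum_nonneg fun i _ => hs i, by simp, fun j _ => ?_⟩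
      exact Finset.single_le_sum (fun i _ => hs i) (Finset.mem_univ j)
    · obtain ⟨i, hi, hmin⟩ := Finset.exists_min_image T s hTn
      exact ⟨s i, hs i, hmin, fun j hj => hswap i hi j hj⟩
  have e1 : ∑ i ∈ T, (s i - τ) * (1 - h i) ≥ 0 :=
    Finset.sum_nonneg fun i hi => mul_nonneg (sub_nonneg.2 (hτ1 i hi)) (sub_nonneg.2 (h1 i))
  have e2 : ∑ j ∈ Tᶜ, (τ - s j) * h j ≥ 0 :=
    Finset.sum_nonneg fun j hj => mul_nonneg (sub_nonneg.2 (hτ2 j (Finset.mem_compl.1 hj))) (h0 j)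
  have e3 : ∑ i ∈ T, (s i - τ) * (1 - h i) = ∑ i ∈ T, s i * (1 - h i) - τ * q + τ * ∑ i ∈ T, h i := by
    rw [← hTq, ← nsmul_one T.card, ← Finset.sum_const, Finset.mul_sum, Finset.mul_sum,
      ← Finset.sum_sub_distrib, ← Finset.sum_add_distrib]
    exact Finset.sum_congr rfl fun i _ => by ring
  have e4 : ∑ j ∈ Tᶜ, (τ - s j) * h j = τ * ∑ j ∈ Tᶜ, h j - ∑ j ∈ Tᶜ, s j + ∑ j ∈ Tᶜ, s j * (1 - h j) := by
    rw [Finset.mul_sum, ← Finset.sum_sub_distrib, ← Finset.sum_add_distrib]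
    exact Finset.sum_congr rfl fun i _ => by ring
  have e5 := Finset.sum_add_sum_compl T h
  have e6 := Finset.sum_add_sum_compl T fun i => s i * (1 - h i)
  have e7 : τ * (∑ i, h i) ≤ τ * q := mul_le_mul_of_nonneg_left hq hτ0
  rw [← e5] at e7
  rw [← e6]
  linarith

theorem gram_spectral (A : Matrix m n K) : ∃ (V : Matrix n n K) (lam : n → ℝ),
    Vᴴ * V = 1 ∧ V * Vᴴ = 1 ∧ (∀ i, 0 ≤ lam i) ∧ Aᴴ * A = V * dg K lam * Vᴴ ∧
    (Finset.univ.filter fun i => lam i ≠ 0).card = A.rank := by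
  have hp := Matrix.posSemidef_conjTranspose_mul_self A
  have hA : (Aᴴ * A).IsHermitian := hp.1
  refine ⟨hA.eigenvectorUnitary, hA.eigenvalues, ?_, ?_, hp.eigenvalues_nonneg, ?_, ?_⟩
  · exact Unitary.coe_star_mul_self hA.eigenvectorUnitary
  · exact Unitary.coe_mul_star_self hA.eigenvectorUnitary
  · conv_lhs => rw [hA.spectral_theorem, Unitary.conjStarAlgAut_apply]
    rfl
  · rw [← rank_conjTranspose_mul_self, hA.rank_eq_card_non_zero_eigs, Fintype.card_subtype]

theorem frobSq_eq_trace (B : Matrix m n K) : frobSq B = RCLike.re (Bᴴ * B).trace := by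
  rw [Matrix.trace, map_sum, frobSq, Finset.sum_comm]
  refine Finset.sum_congr rfl fun j _ => ?_
  simp only [diag_apply, Matrix.mul_apply, map_sum, conjTranspose_apply]
  refine Finset.sum_congr rfl fun i _ => ?_
  rw [RCLike.star_def, RCLike.conj_mul]
  norm_cast

theorem IsProj.diag_nonneg {P : Matrix n n K} (hP : IsProj P) (i : n) : 0 ≤ RCLike.re (P i i) := by
  rw [← hP.sum_row]; exact Finset.sum_nonneg fun _ _ => by positivity

theorem IsProj.diag_le {P : Matrix n n K} (hP : IsProj P) (i : n) : RCLike.re (P i i) ≤ 1 :=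
  (RCLike.re_le_norm _).trans (hP.norm_le_one i i)

theorem IsProj.conj {P : Matrix n n K} (hP : IsProj P) {V : Matrix n n K} (hV : V * Vᴴ = 1) :
    IsProj (Vᴴ * P * V) := by
  refine ⟨by simp [conjTranspose_mul, hP.herm, Matrix.mul_assoc], ?_⟩
  calc Vᴴ * P * V * (Vᴴ * P * V) = Vᴴ * P * (V * Vᴴ) * P * V := by simp only [Matrix.mul_assoc]
    _ = _ := by rw [hV, Matrix.mul_one, Matrix.mul_assoc Vᴴ, hP.idem]

theorem row_proj (B : Matrix m n K) : ∃ P : Matrix n n K, IsProj P ∧ B * P = B ∧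
    RCLike.re P.trace = B.rank := by
  obtain ⟨V, lam, h1, h2, h3, h4, h5⟩ := gram_spectral B
  set D : Matrix n n K := Matrix.diagonal fun i => if lam i ≠ 0 then 1 else 0 with hD
  have hDp : IsProj D := by
    refine ⟨?_, ?_⟩
    · rw [hD, diagonal_conjTranspose]
      congr 1
      ext i
      by_cases h : lam i = 0 <;> simp [h]
    · rw [hD, diagonal_mul_diagonal]
      congr 1
      ext i
      by_cases h : lam i = 0 <;> simp [h]
  have hP : IsProj (V * D * Vᴴ) := by
    have := hDp.conj (V := Vᴴ) (by simpa using h1)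
    simpa using this
  refine ⟨V * D * Vᴴ, hP, ?_, ?_⟩
  · have h0 : B * (1 - V * D * Vᴴ) = 0 := by
      rw [← conjTranspose_mul_self_eq_zero, conjTranspose_mul, hP.compl.herm, Matrix.mul_assoc,
        ← Matrix.mul_assoc Bᴴ, h4]
      have : V * dg K lam * Vᴴ * (1 - V * D * Vᴴ) = 0 := by
        have e : dg K lam * D = dg K lam := by
          rw [hD, dg, diagonal_mul_diagonal]
          congr 1
          ext i
          by_cases h : lam i = 0 <;> simp [h]
        rw [Matrix.mul_sub, Matrix.mul_one, sub_eq_zero]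
        calc V * dg K lam * Vᴴ = V * (dg K lam * D) * Vᴴ := by rw [e]
          _ = V * dg K lam * (Vᴴ * V) * D * Vᴴ := by rw [h1]; simp only [Matrix.mul_assoc, Matrix.one_mul]
          _ = _ := by simp only [Matrix.mul_assoc]
      rw [this, Matrix.mul_zero]
    rw [Matrix.mul_sub, Matrix.mul_one, sub_eq_zero] at h0
    exact h0.symm
  · rw [Matrix.trace_mul_comm, ← Matrix.mul_assoc, h1, Matrix.one_mul, hD, trace_diagonal, ← h5]
    simp [Finset.sum_ite]

theorem trace_dg_mul (lam : n → ℝ) (Q : Matrix n n K) :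
    RCLike.re (dg K lam * Q).trace = ∑ i, lam i * RCLike.re (Q i i) := by
  rw [Matrix.trace, map_sum]
  refine Finset.sum_congr rfl fun i _ => ?_
  rw [diag_apply, dg, diagonal_mul, RCLike.re_ofReal_mul]

/-- Eckart-Young lower bound. -/
theorem eckart_young (A B : Matrix m n K) (V : Matrix n n K) (lam : n → ℝ) (hV : V * Vᴴ = 1)
    (hA : Aᴴ * A = V * dg K lam * Vᴴ) : ∃ h : n → ℝ, (∀ i, 0 ≤ h i) ∧ (∀ i, h i ≤ 1) ∧
    ∑ i, h i = B.rank ∧ ∑ i, lam i * (1 - h i) ≤ frobSq (A - B) := by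
  obtain ⟨P, hP, hBP, hPt⟩ := row_proj B
  have hQ := hP.conj hV
  have hV' : Vᴴ * V = 1 := mul_eq_one_comm.1 hV
  refine ⟨fun i => RCLike.re ((Vᴴ * P * V) i i), hQ.diag_nonneg, hQ.diag_le, ?_, ?_⟩
  · rw [← hPt, ← map_sum]
    congr 1
    change (Vᴴ * P * V).trace = _
    rw [Matrix.trace_mul_comm, ← Matrix.mul_assoc, hV, Matrix.one_mul]
  · have e1 : (A - B) * (1 - P) = A * (1 - P) := by
      rw [Matrix.sub_mul, Matrix.mul_sub B, Matrix.mul_one, hBP]; simp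
    have e2 : frobSq (A * (1 - P)) = ∑ i, lam i * (1 - RCLike.re ((Vᴴ * P * V) i i)) := by
      rw [frobSq_eq_trace, conjTranspose_mul, hP.compl.herm, Matrix.mul_assoc, Matrix.trace_mul_comm,
        Matrix.mul_assoc, Matrix.mul_assoc, hP.compl.idem, ← Matrix.mul_assoc, hA, Matrix.mul_assoc,
        Matrix.mul_assoc, Matrix.trace_mul_comm, Matrix.mul_assoc, trace_dg_mul]
      refine Finset.sum_congr rfl fun i _ => ?_
      rw [Matrix.mul_sub, Matrix.mul_one, Matrix.sub_mul, hV', Matrix.sub_apply, Matrix.one_apply_eq, map_sub,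
        RCLike.one_re]
    rw [← e2, ← e1]
    have e3 : frobSq (A - B) = frobSq ((A - B) * (1 - P)) + frobSq ((A - B) * P) := by
      have key : ∀ Q : Matrix n n K, IsProj Q →
          (((A - B) * Q)ᴴ * ((A - B) * Q)).trace = ((A - B)ᴴ * (A - B) * Q).trace := by
        intro Q hQ
        rw [conjTranspose_mul, hQ.herm, Matrix.mul_assoc, Matrix.trace_mul_comm, Matrix.mul_assoc,
          Matrix.mul_assoc, hQ.idem, Matrix.mul_assoc]
      rw [frobSq_eq_trace, frobSq_eq_trace, frobSq_eq_trace, key _ hP.compl, key _ hP, ← map_add,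
        ← Matrix.trace_add, ← Matrix.mul_add]
      simp
    have e4 : 0 ≤ frobSq ((A - B) * P) :=
      Finset.sum_nonneg fun _ _ => Finset.sum_nonneg fun _ _ => by positivity
    linarith

end EY

section Reduction
variable {K : Type*} [RCLike K]

theorem penrose_proj {m k : Type*} [Fintype m] [Fintype k] [DecidableEq m] [DecidableEq k]
    (F : Matrix m k K) (X : Matrix k m K) (hX : IsMoorePenrose F X) (hG : IsUnit (Fᴴ * F).det) :
    1 - F * X = Pc F := by
  obtain ⟨h1, -, h3, -⟩ := hX
  have e1 : Pc F * (F * X) = 0 := by rw [← Matrix.mul_assoc, Pc_mul F hG, Matrix.zero_mul]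
  have e2 : (F * X) * Pc F = 0 := by
    have := congrArg conjTranspose e1
    rwa [conjTranspose_mul, h3, Pc_herm, conjTranspose_zero] at this
  have e3 : F * X * (F * (Fᴴ * F)⁻¹ * Fᴴ) = F * (Fᴴ * F)⁻¹ * Fᴴ := by
    rw [← Matrix.mul_assoc, ← Matrix.mul_assoc, h1]
  rw [Pc, Matrix.mul_sub, Matrix.mul_one, e3, sub_eq_zero] at e2
  rw [Pc, e2]

theorem frob_reduce {m n k : Type*} [Fintype m] [Fintype n] [Fintype k] [DecidableEq m] [DecidableEq n]
    [DecidableEq k] (A : Matrix m n K) (V : Matrix n n K) (lam : n → ℝ) (hV : Vᴴ * V = 1)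
    (hl : ∀ i, 0 ≤ lam i) (hA : Aᴴ * A = V * dg K lam * Vᴴ) (M : Matrix n k K) (X : Matrix k m K)
    (hX : IsMoorePenrose (A * M) X)
    (hO : ∀ x, ((Vᴴ * M).submatrix (Subtype.val : {i // lam i ≠ 0} → n) id) *ᵥ x = 0 → x = 0) :
    frobSq (A - (A * M) * (X * A)) = ∑ i : {i // lam i ≠ 0}, Real.sqrt (lam i) ^ 2 *
      RCLike.re (Pc (dg K (fun i : {i // lam i ≠ 0} => Real.sqrt (lam i)) *
        (Vᴴ * M).submatrix (Subtype.val : {i // lam i ≠ 0} → n) id) i i) := by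
  set O := Vᴴ * M with hOdef
  set Os := O.submatrix (Subtype.val : {i // lam i ≠ 0} → n) id with hOs
  set e : {i // lam i ≠ 0} → ℝ := fun i => Real.sqrt (lam i) with he
  have hepos : ∀ i, 0 < e i := fun i => Real.sqrt_pos.2 (lt_of_le_of_ne (hl i) (Ne.symm i.2))
  have hesq : ∀ i, e i ^ 2 = lam i := fun i => Real.sq_sqrt (hl i)
  set Φ := dg K e * Os with hΦ
  have hGΦ : IsUnit (Φᴴ * Φ).det := isUnit_gram (dg_inj e hepos Os hO)
  have hsum : ∀ f : n → K, ∑ i, (lam i : K) * f i = ∑ i : {i // lam i ≠ 0}, (lam i : K) * f i := by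
    intro f
    rw [← Finset.sum_subtype (Finset.univ.filter fun i => lam i ≠ 0) (by simp)
      (fun i => (lam i : K) * f i), Finset.sum_filter]
    refine Finset.sum_congr rfl fun i _ => ?_
    by_cases h : lam i = 0 <;> simp [h]
  have hFF : (A * M)ᴴ * (A * M) = Φᴴ * Φ := by
    have : (A * M)ᴴ * (A * M) = Oᴴ * dg K lam * O := by
      rw [conjTranspose_mul, Matrix.mul_assoc, ← Matrix.mul_assoc Aᴴ, hA, hOdef, conjTranspose_mul,
        conjTranspose_conjTranspose]
      simp only [Matrix.mul_assoc]
    rw [this]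
    ext a b
    have hsb := hsum fun i => star (O i a) * O i b
    rw [Matrix.mul_apply, Matrix.mul_apply]
    calc _ = ∑ i, (lam i : K) * (star (O i a) * O i b) := by
          refine Finset.sum_congr rfl fun i _ => ?_
          rw [dg, mul_diagonal, conjTranspose_apply]; ring
      _ = _ := hsb
      _ = _ := by
          refine Finset.sum_congr rfl fun i _ => ?_
          rw [conjTranspose_apply, hΦ, dg, diagonal_mul, diagonal_mul, ← hesq]
          simp [hOs]
          ring
  have hGF : IsUnit ((A * M)ᴴ * (A * M)).det := hFF ▸ hGΦ
  have hPc := penrose_proj (A * M) X hX hGF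
  have h1 : A - (A * M) * (X * A) = Pc (A * M) * A := by
    rw [← hPc, Matrix.sub_mul, Matrix.one_mul, Matrix.mul_assoc (A * M) X A]
  have hp := Pc_isProj _ hGF
  set G := (Φᴴ * Φ)⁻¹ with hG
  have h2 : frobSq (A - (A * M) * (X * A)) = RCLike.re (dg K lam - dg K lam * (O * G * Oᴴ) * dg K lam).trace := by
    rw [h1, frobSq_eq_trace, conjTranspose_mul, hp.herm, Matrix.mul_assoc, ← Matrix.mul_assoc (Pc _), hp.idem]
    congr 1
    have : Aᴴ * (Pc (A * M) * A) = V * ((dg K lam - dg K lam * (O * G * Oᴴ) * dg K lam) * Vᴴ) := by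
      rw [Pc, hFF, Matrix.sub_mul, Matrix.one_mul, Matrix.mul_sub, hA, Matrix.sub_mul, Matrix.mul_sub,
        ← Matrix.mul_assoc V]
      congr 1
      calc Aᴴ * (A * M * G * (A * M)ᴴ * A) = (Aᴴ * A) * M * G * Mᴴ * (Aᴴ * A) := by
            rw [conjTranspose_mul]; simp only [Matrix.mul_assoc]
        _ = _ := by
            rw [hA, hOdef, conjTranspose_mul, conjTranspose_conjTranspose]; simp only [Matrix.mul_assoc]
    rw [this, Matrix.trace_mul_comm, Matrix.mul_assoc, hV, Matrix.mul_one]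
  rw [h2]
  have h3 : (dg K lam - dg K lam * (O * G * Oᴴ) * dg K lam).trace =
      ∑ i, (lam i : K) * (1 - (O * G * Oᴴ) i i * lam i) := by
    rw [Matrix.trace]
    refine Finset.sum_congr rfl fun i _ => ?_
    simp only [diag_apply, dg, Matrix.sub_apply, diagonal_apply_eq, mul_diagonal, diagonal_mul]
    ring
  rw [h3, hsum, map_sum]
  refine Finset.sum_congr rfl fun i _ => ?_
  have h4 : Pc Φ i i = 1 - (O * G * Oᴴ) i i * lam i := by
    have h5 : (Os * G * Osᴴ) i i = (O * G * Oᴴ) i i := by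
      simp only [Matrix.mul_apply, hOs, conjTranspose_apply, submatrix_apply, id]
    have h6 : Φ * G * Φᴴ = dg K e * (Os * G * Osᴴ) * dg K e := by
      have : (dg K e)ᴴ = dg K e := by
        rw [dg, diagonal_conjTranspose]; congr 1; ext i; simp
      rw [hΦ, conjTranspose_mul, this]
      simp only [Matrix.mul_assoc]
    rw [Pc, ← hG, h6, Matrix.sub_apply, Matrix.one_apply_eq, dg, mul_diagonal, diagonal_mul, h5, ← hesq]
    push_cast
    ring
  rw [h4, RCLike.re_ofReal_mul, hesq]

variable [MeasurableSpace K] [BorelSpace K] {Y : Type*} [MeasurableSpace Y]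
variable {μ : Measure Y} [IsProbabilityMeasure μ]
  {n κ : Type*} [Fintype n] [Fintype κ] [DecidableEq n] [DecidableEq κ] {Om : Y → Matrix n κ K}

theorem GoodEmb.sub (h : GoodEmb μ Om) (p : n → Prop) [DecidablePred p]
    (hc : Fintype.card κ ≤ (Finset.univ.filter p).card) :
    GoodEmb μ (fun ω => (Om ω).submatrix (Subtype.val : {i // p i} → n) id) := by
  have : BorelSpace (Matrix n κ K) := matrixBorel
  have : BorelSpace (Matrix {i // p i} κ K) := matrixBorel
  have hsm : Measurable (fun O : Matrix n κ K => O.submatrix (Subtype.val : {i // p i} → n) id) := by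
    apply Continuous.measurable; fun_prop
  refine ⟨hsm.comp h.meas, ?_, ?_⟩
  · intro U hU
    let E := Equiv.sumCompl p
    let W : Matrix ({i // p i} ⊕ {i // ¬ p i}) ({i // p i} ⊕ {i // ¬ p i}) K := fromBlocks U 0 0 1
    have hUU : U * Uᴴ = 1 := (Matrix.mem_unitaryGroup_iff (A := U)).1 hU
    have hW : W.submatrix E.symm E.symm ∈ unitaryGroup n K := by
      rw [Matrix.mem_unitaryGroup_iff, star_eq_conjTranspose, conjTranspose_submatrix, submatrix_mul_equiv]
      have : W * Wᴴ = 1 := by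
        simp [W, fromBlocks_conjTranspose, fromBlocks_multiply, hUU]
      rw [this, submatrix_one_equiv]
    have key : ∀ O : Matrix n κ K, U * O.submatrix (Subtype.val : {i // p i} → n) id =
        (W.submatrix E.symm E.symm * O).submatrix (Subtype.val : {i // p i} → n) id := by
      intro O
      ext i k
      simp only [Matrix.mul_apply, submatrix_apply, id]
      rw [← E.sum_comp, Fintype.sum_sum_type]
      have hEi : E.symm i.1 = Sum.inl i := by
        rw [Equiv.symm_apply_eq]; rfl
      simp [hEi, W, E]
    simp only [key]
    have e1 : Measure.map (fun ω => (W.submatrix E.symm E.symm * Om ω).submatrix (Subtype.val : {i // p i} → n) id) μ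
        = Measure.map (fun O : Matrix n κ K => O.submatrix (Subtype.val : {i // p i} → n) id)
          (Measure.map (fun ω => W.submatrix E.symm E.symm * Om ω) μ) :=
      (Measure.map_map hsm (h.left _ hW).meas).symm
    rw [e1, h.rot _ hW, Measure.map_map hsm h.meas]
    rfl
  · filter_upwards [h.rows (Finset.univ.filter p) hc] with ω hω x hx
    by_contra hx0
    apply hω
    refine ⟨x, hx0, fun i hi => ?_⟩
    exact congrFun hx ⟨i, (Finset.mem_filter.1 hi).2⟩

end Reduction

/-- **Randomized SVD, sharp upper bound** (Theorem 3.2): for a full-rank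
rotation-invariant random embedding `Ω` and any matrix `A` with `r = rank A ≥ ℓ`,
`E‖A − Π_{AΩ}A‖_F² ≤ ((r − ℓ)/(r − q)) (1 + q/(ℓ − q − α_K)) ‖A − [A]_q‖_F²`
for all `q < ℓ − α_K`. -/
theorem randomized_svd_sharp_upper_bound
    {K : Type*} [RCLike K] [MeasurableSpace K] [BorelSpace K]
    {Y : Type*} [MeasurableSpace Y] (μ : Measure Y) [IsProbabilityMeasure μ]
    (pinv : (m n : ℕ) → Matrix (Fin m) (Fin n) K → Matrix (Fin n) (Fin m) K)
    (hpinv : ∀ (m n : ℕ) (A : Matrix (Fin m) (Fin n) K), IsMoorePenrose A (pinv m n A))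
    (n ℓ d : ℕ) (hℓn : ℓ ≤ n)
    (M : Y → Matrix (Fin n) (Fin ℓ) K)
    (hMmeas : Measurable M)
    (hMfull : ∀ᵐ ω ∂μ, (M ω).rank = ℓ)
    (hMrot : RotationInvariant μ M)
    (A : Matrix (Fin d) (Fin n) K) (hrank : ℓ ≤ A.rank) :
    ∀ (q : ℕ) (Aq : Matrix (Fin d) (Fin n) K),
      (q : ℝ) < (ℓ : ℝ) - alphaK K → IsBestRankApprox q A Aq →
      ∫ ω, frobSq (A - (A * M ω) * (pinv d ℓ (A * M ω) * A)) ∂μ ≤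
        ((A.rank : ℝ) - (ℓ : ℝ)) / ((A.rank : ℝ) - (q : ℝ)) *
          ((1 + (q : ℝ) / ((ℓ : ℝ) - (q : ℝ) - alphaK K)) * frobSq (A - Aq)) := by
  intro q Aq hq hAq
  have hcardκ : Fintype.card (Fin ℓ) = ℓ := Fintype.card_fin ℓ
  have ha0 := alphaK_nonneg K
  have hG : GoodEmb μ M := by
    refine ⟨hMmeas, hMrot, ?_⟩
    filter_upwards [hMfull] with ω hω x hx
    have h1 := LinearMap.finrank_range_add_finrank_ker (M ω).mulVecLin
    have h2 : Module.finrank K (LinearMap.range (M ω).mulVecLin) = ℓ := hω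
    rw [h2, Module.finrank_fintype_fun_eq_card, hcardκ] at h1
    have h3 : Module.finrank K (LinearMap.ker (M ω).mulVecLin) = 0 := by omega
    have h4 := Submodule.finrank_eq_zero.1 h3
    have h5 : x ∈ LinearMap.ker (M ω).mulVecLin := by simpa using hx
    rw [h4] at h5
    simpa using h5
  obtain ⟨V, lam, hV1, hV2, hl, hA, hr⟩ := gram_spectral A
  have hVu : Vᴴ ∈ unitaryGroup (Fin n) K := by
    rw [Matrix.mem_unitaryGroup_iff, star_eq_conjTranspose, conjTranspose_conjTranspose, hV1]
  have hGV := hG.left Vᴴ hVu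
  have hGS := hGV.sub (fun i => lam i ≠ 0) (by rw [hr, hcardκ]; exact hrank)
  have hcardι : Fintype.card {i // lam i ≠ 0} = A.rank := by
    rw [Fintype.card_subtype, hr]
  obtain ⟨h, h0, h1, hs, hle⟩ := eckart_young A Aq V lam hV2 hA
  have hqℓ : (q : ℝ) < ℓ := by linarith
  have hqℓ' : q < ℓ := by exact_mod_cast hqℓ
  have hlr : (ℓ : ℝ) ≤ A.rank := by exact_mod_cast hrank
  have hsub : ∀ f : Fin n → ℝ, ∑ i : {i // lam i ≠ 0}, f i = ∑ i, if lam i ≠ 0 then f i else 0 := by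
    intro f
    rw [← Finset.sum_filter, Finset.sum_subtype (p := fun i => lam i ≠ 0) (Finset.univ.filter fun i => lam i ≠ 0) (by simp) f]
  obtain ⟨T, hT, hTs⟩ := top_sum (fun i : {i // lam i ≠ 0} => lam i) (fun i => h i) (fun i => hl i)
    (fun i => h0 i) (fun i => h1 i) q (by
      rw [hsub h]
      calc _ ≤ ∑ i, h i := Finset.sum_le_sum fun i _ => by split_ifs <;> first | exact le_rfl | exact h0 i
        _ = _ := hs
        _ ≤ q := by exact_mod_cast hAq.1) (by rw [hcardι]; omega)
  have hTs' : ∑ j ∈ Tᶜ, Real.sqrt (lam j) ^ 2 ≤ frobSq (A - Aq) := by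
    calc ∑ j ∈ Tᶜ, Real.sqrt (lam j) ^ 2 = ∑ j ∈ Tᶜ, lam j :=
          Finset.sum_congr rfl fun j _ => Real.sq_sqrt (hl j)
      _ ≤ _ := hTs
      _ = ∑ i, lam i * (1 - h i) := by
          rw [hsub fun i => lam i * (1 - h i)]
          refine Finset.sum_congr rfl fun i _ => ?_
          by_cases hi : lam i = 0 <;> simp [hi]
      _ ≤ _ := hle
  have hb := hGS.bound (fun i => Real.sqrt (lam i))
    (fun i => Real.sqrt_pos.2 (lt_of_le_of_ne (hl i) (Ne.symm i.2))) T (by rw [hT, hcardκ]; exact hq)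
    (by rw [hcardι, hcardκ]; exact hrank)
  rw [hcardι, hcardκ, hT] at hb
  have heq : ∫ ω, frobSq (A - (A * M ω) * (pinv d ℓ (A * M ω) * A)) ∂μ =
      ∫ ω, ∑ i : {i // lam i ≠ 0}, Real.sqrt (lam i) ^ 2 *
      RCLike.re (Pc (dg K (fun i : {i // lam i ≠ 0} => Real.sqrt (lam i)) *
        (Vᴴ * M ω).submatrix (Subtype.val : {i // lam i ≠ 0} → Fin n) id) i i) ∂μ := by
    apply integral_congr_ae
    filter_upwards [hGS.inj] with ω hω
    exact frob_reduce A V lam hV1 hl hA (M ω) _ (hpinv _ _ _) hω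
  rw [heq]
  refine hb.trans ?_
  have hd : 0 < (ℓ : ℝ) - q - alphaK K := by linarith
  have hd2 : 0 < (A.rank : ℝ) - q := by linarith
  have hd3 : 0 ≤ (A.rank : ℝ) - ℓ := by linarith
  gcongr
end
end
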